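/- Cut-off for high-temperature Glauber dynamics: fix 0 ≤ β < 1. The Glauber dynamics for the Curie-Weiss Ising model on the complete graph K_n exhibits a cut-off at t_n = n·log n / (2(1-β)) with window size n; that is, lim_{γ→∞} liminf_{n→∞} d_n(t_n − γn) = 1 and lim_{γ→∞} limsup_{n→∞} d_n(t_n + γn) = 0. -/

import Mathlib

open Filter Real

namespace CW

/-- Configurations of the Curie-Weiss model on `n` vertices:
`true` encodes spin `+1` and `false` encodes spin `-1`. -/
abbrev Config (n : ℕ) := Fin n → Bool

noncomputable section

/-- The spin (±1) at site `i`. -/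
def spin {n : ℕ} (σ : Config n) (i : Fin n) : ℝ := if σ i then 1 else -1

/-- Normalized magnetization `S(σ) = n⁻¹ ∑ᵢ σ(i)`. -/
def mag {n : ℕ} (σ : Config n) : ℝ := (∑ i, spin σ i) / n

/-- `p₊(s) = (1 + tanh(βs))/2`. -/
def pPlus (β s : ℝ) : ℝ := (1 + Real.tanh (β * s)) / 2

/-- One-step transition kernel of the Glauber dynamics for the Curie-Weiss
model: a uniformly chosen site `i` is refreshed, becoming `+1` with
probability `p₊(S(σ) - σ(i)/n)`. -/
def glauberKernel (β : ℝ) (n : ℕ) (σ η : Config n) : ℝ :=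
  (1 / n) * ∑ i : Fin n,
    if ∀ j, j ≠ i → η j = σ j then
      (if η i then pPlus β (mag σ - spin σ i / n)
       else 1 - pPlus β (mag σ - spin σ i / n))
    else 0

/-- Law of the Glauber dynamics at time `t` started from `σ`. -/
def glauberLaw (β : ℝ) (n : ℕ) : ℕ → Config n → Config n → ℝ
  | 0, σ, η => if η = σ then 1 else 0
  | t + 1, σ, η => ∑ τ : Config n, glauberLaw β n t σ τ * glauberKernel β n τ η

/-- The (normalized) exponent in the Curie-Weiss measure. -/
def cwExponent {n : ℕ} (β : ℝ) (σ : Config n) : ℝ :=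
  (β / n) * ∑ i : Fin n, ∑ j : Fin n, if i < j then spin σ i * spin σ j else 0

/-- The Curie-Weiss (mean-field Ising) probability measure
`μ(σ) = Z(β)⁻¹ exp((β/n) ∑_{i<j} σ(i)σ(j))`. -/
def cwMeasure (β : ℝ) (n : ℕ) (σ : Config n) : ℝ :=
  Real.exp (cwExponent β σ) / ∑ η : Config n, Real.exp (cwExponent β η)

/-- Total variation distance between two (discrete) distributions. -/
def tvDist {Ω : Type*} [Fintype Ω] (μ ν : Ω → ℝ) : ℝ :=
  (∑ x, |μ x - ν x|) / 2

/-- Worst-case total variation distance to stationarity at time `t`. -/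
def glauberDist (β : ℝ) (n t : ℕ) : ℝ :=
  ⨆ σ : Config n, tvDist (glauberLaw β n t σ) (cwMeasure β n)

/-! ### Elementary facts on `tanh` and `pPlus` -/

lemma hasDerivAt_tanh (x : ℝ) : HasDerivAt Real.tanh (1 / Real.cosh x ^ 2) x := by
  have h := (Real.hasDerivAt_sinh x).div (Real.hasDerivAt_cosh x) (Real.cosh_pos x).ne'
  have e : Real.tanh = Real.sinh / Real.cosh := by
    funext y; simp [Real.tanh_eq_sinh_div_cosh]
  have h2 : Real.cosh x * Real.cosh x - Real.sinh x * Real.sinh x = 1 := by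
    linear_combination Real.cosh_sq x
  rw [h2] at h
  rwa [e]

lemma abs_tanh_sub_tanh_le (x y : ℝ) : |Real.tanh x - Real.tanh y| ≤ |x - y| := by
  have h := Convex.norm_image_sub_le_of_norm_hasDerivWithin_le (s := Set.univ) (C := 1)
    (f := Real.tanh) (f' := fun x => 1 / Real.cosh x ^ 2) (x := y) (y := x)
    (fun x _ => (hasDerivAt_tanh x).hasDerivWithinAt) (fun x _ => by
      have h1 := Real.one_le_cosh x
      rw [Real.norm_of_nonneg (by positivity)]
      exact div_le_one_of_le₀ (one_le_pow₀ h1) (by positivity))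
    convex_univ (Set.mem_univ _) (Set.mem_univ _)
  simpa using h

lemma tanh_eq_one_sub (x : ℝ) : Real.tanh x = 1 - 2 / (Real.exp (2 * x) + 1) := by
  rw [Real.tanh_eq, Real.exp_neg, two_mul, Real.exp_add]
  have := Real.exp_pos x
  field_simp
  ring

lemma sub_sq_le_tanh (x : ℝ) : x - x ^ 2 ≤ Real.tanh x := by
  rcases le_total x 0 with hx | hx
  · have h := abs_tanh_sub_tanh_le x 0
    rw [Real.tanh_zero, sub_zero, sub_zero, abs_of_nonpos hx] at h
    nlinarith [neg_abs_le (Real.tanh x)]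
  · rw [tanh_eq_one_sub]
    have h1 : 2 * x + 1 ≤ Real.exp (2 * x) := Real.add_one_le_exp _
    have h2 : 2 / (Real.exp (2 * x) + 1) ≤ 2 / (2 * x + 2) :=
      div_le_div_of_nonneg_left (by norm_num) (by linarith) (by linarith)
    have h3 : 2 / (2 * x + 2) ≤ 1 - x + x ^ 2 := by
      rw [div_le_iff₀ (by linarith)]
      nlinarith [pow_nonneg hx 3]
    linarith

lemma mul_tanh_le_sq {b x : ℝ} (hb : 0 ≤ b) : x * Real.tanh (b * x) ≤ b * x ^ 2 := by
  have h := abs_tanh_sub_tanh_le (b * x) 0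
  rw [Real.tanh_zero, sub_zero, sub_zero, abs_mul, abs_of_nonneg hb] at h
  calc x * Real.tanh (b * x) ≤ |x| * |Real.tanh (b * x)| := by
        rw [← abs_mul]; exact le_abs_self _
    _ ≤ |x| * (b * |x|) := by gcongr
    _ = b * x ^ 2 := by rw [← sq_abs x]; ring

lemma abs_tanh_le_of_abs_le_one {x : ℝ} (hx : |x| ≤ 1) : |Real.tanh x| ≤ 4 / 5 := by
  have key : ∀ y : ℝ, y ≤ 1 → Real.tanh y ≤ 4 / 5 := by
    intro y hy
    rw [tanh_eq_one_sub]
    have h1 : Real.exp (2 * y) ≤ 9 := by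
      calc Real.exp (2 * y) ≤ Real.exp (1 + 1) := Real.exp_le_exp.2 (by linarith)
        _ = Real.exp 1 * Real.exp 1 := Real.exp_add _ _
        _ ≤ 3 * 3 := by gcongr <;> linarith [Real.exp_one_lt_d9]
        _ = 9 := by norm_num
    have h2 : 1 / 5 ≤ 2 / (Real.exp (2 * y) + 1) := by
      rw [div_le_div_iff₀ (by norm_num) (by positivity)]
      linarith
    linarith
  rw [abs_le] at hx ⊢
  have := key (-x) (by linarith)
  rw [Real.tanh_neg] at this
  exact ⟨by linarith, key x hx.2⟩

lemma pPlus_eq_exp (β s : ℝ) :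
    pPlus β s = Real.exp (2 * β * s) / (Real.exp (2 * β * s) + 1) := by
  rw [pPlus, tanh_eq_one_sub, ← mul_assoc]
  have := Real.exp_pos (2 * β * s)
  field_simp
  ring

lemma abs_pPlus_sub_pPlus_le {β : ℝ} (hβ : 0 ≤ β) (s s' : ℝ) :
    |pPlus β s - pPlus β s'| ≤ β / 2 * |s - s'| := by
  have h := abs_tanh_sub_tanh_le (β * s) (β * s')
  rw [← mul_sub, abs_mul, abs_of_nonneg hβ] at h
  have e : pPlus β s - pPlus β s' = (Real.tanh (β * s) - Real.tanh (β * s')) / 2 := by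
    simp only [pPlus]; ring
  rw [e, abs_div, abs_two]
  linarith

/-! ### The transition operator and discrete derivatives -/

/-- Conditional probability of a `+1` spin at site `i` given the other spins. -/
def plusProb (β : ℝ) {n : ℕ} (σ : Config n) (i : Fin n) : ℝ :=
  pPlus β (mag σ - spin σ i / n)

/-- Action on functions of the heat-bath update of site `i`. -/
def siteStep (β : ℝ) {n : ℕ} (i : Fin n) (g : Config n → ℝ) (σ : Config n) : ℝ :=
  plusProb β σ i * g (Function.update σ i true) +
    (1 - plusProb β σ i) * g (Function.update σ i false)

/-- Transition operator of the Glauber dynamics acting on functions. -/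
def step (β : ℝ) {n : ℕ} (g : Config n → ℝ) (σ : Config n) : ℝ :=
  (1 / n) * ∑ i, siteStep β i g σ

/-- Discrete derivative in direction `i`. -/
def discDeriv {n : ℕ} (g : Config n → ℝ) (i : Fin n) (σ : Config n) : ℝ :=
  g (Function.update σ i true) - g (Function.update σ i false)

/-- Squared Euclidean norm of the discrete gradient. -/
def gradSq {n : ℕ} (g : Config n → ℝ) (σ : Config n) : ℝ :=
  ∑ i, discDeriv g i σ ^ 2

lemma discDeriv_update {n : ℕ} (g : Config n → ℝ) (i : Fin n) (σ : Config n) (b : Bool) :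
    discDeriv g i (Function.update σ i b) = discDeriv g i σ := by
  simp [discDeriv]

lemma abs_spin {n : ℕ} (σ : Config n) (i : Fin n) : |spin σ i| = 1 := by
  unfold spin; split_ifs <;> simp

lemma spin_sq {n : ℕ} (σ : Config n) (i : Fin n) : spin σ i ^ 2 = 1 := by
  rw [← sq_abs, abs_spin, one_pow]

lemma spin_update_self {n : ℕ} (σ : Config n) (i : Fin n) (b : Bool) :
    spin (Function.update σ i b) i = if b then 1 else -1 := by
  simp [spin]

lemma spin_update_of_ne {n : ℕ} (σ : Config n) {i j : Fin n} (h : j ≠ i) (b : Bool) :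
    spin (Function.update σ i b) j = spin σ j := by
  simp [spin, h]

lemma mag_sub_spin {n : ℕ} (σ : Config n) (i : Fin n) :
    mag σ - spin σ i / n = (∑ j ∈ Finset.univ.erase i, spin σ j) / n := by
  rw [mag, ← Finset.add_sum_erase _ _ (Finset.mem_univ i)]
  ring

lemma mag_update {n : ℕ} (σ : Config n) (i : Fin n) (b : Bool) :
    mag (Function.update σ i b) = mag σ + ((if b then 1 else -1) - spin σ i) / n := by
  have h1 := mag_sub_spin σ i
  have h2 := mag_sub_spin (Function.update σ i b) i
  have h3 : ∑ j ∈ Finset.univ.erase i, spin (Function.update σ i b) j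
      = ∑ j ∈ Finset.univ.erase i, spin σ j :=
    Finset.sum_congr rfl fun j hj => spin_update_of_ne σ (Finset.ne_of_mem_erase hj) b
  rw [h3, ← h1, spin_update_self] at h2
  rw [sub_eq_iff_eq_add.1 h2]
  ring

lemma plusProb_update_self (β : ℝ) {n : ℕ} (σ : Config n) (i : Fin n) (b : Bool) :
    plusProb β (Function.update σ i b) i = plusProb β σ i := by
  rw [plusProb, plusProb, mag_update, spin_update_self]
  congr 1
  ring

lemma abs_mag_le_one {n : ℕ} (σ : Config n) : |mag σ| ≤ 1 := by
  rw [mag, abs_div, Nat.abs_cast]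
  refine div_le_one_of_le₀ ?_ (by positivity)
  refine (Finset.abs_sum_le_sum_abs _ _).trans ?_
  simp [abs_spin]

lemma abs_mag_sub_spin_le_one {n : ℕ} (σ : Config n) (i : Fin n) :
    |mag σ - spin σ i / n| ≤ 1 := by
  rw [mag_sub_spin, abs_div, Nat.abs_cast]
  refine div_le_one_of_le₀ ?_ (by positivity)
  refine (Finset.abs_sum_le_sum_abs _ _).trans ?_
  simp only [abs_spin, Finset.sum_const, nsmul_eq_mul, mul_one, Nat.cast_le]
  exact (Finset.card_le_univ _).trans (by simp)

lemma plusProb_mem {β : ℝ} (hβ0 : 0 ≤ β) (hβ1 : β < 1) {n : ℕ} (σ : Config n) (i : Fin n) :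
    1 / 10 ≤ plusProb β σ i ∧ 1 / 10 ≤ 1 - plusProb β σ i := by
  have h : |β * (mag σ - spin σ i / n)| ≤ 1 := by
    rw [abs_mul, abs_of_nonneg hβ0]
    exact mul_le_one₀ hβ1.le (abs_nonneg _) (abs_mag_sub_spin_le_one σ i)
  have h2 := abs_le.1 (abs_tanh_le_of_abs_le_one h)
  simp only [plusProb, pPlus]
  constructor <;> linarith

lemma abs_plusProb_update_sub_le {β : ℝ} (hβ0 : 0 ≤ β) {n : ℕ} (σ : Config n) {i j : Fin n}
    (h : j ≠ i) (b c : Bool) :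
    |plusProb β (Function.update σ i b) j - plusProb β (Function.update σ i c) j| ≤ β / n := by
  refine (abs_pPlus_sub_pPlus_le hβ0 _ _).trans ?_
  rw [mag_update, mag_update, spin_update_of_ne _ h, spin_update_of_ne _ h]
  have e : |(mag σ + ((if b then 1 else -1) - spin σ i) / n - spin σ j / n) -
      (mag σ + ((if c then 1 else -1) - spin σ i) / n - spin σ j / n)| ≤ 2 / n := by
    have e1 : (mag σ + ((if b then 1 else -1) - spin σ i) / n - spin σ j / n) -
      (mag σ + ((if c then 1 else -1) - spin σ i) / n - spin σ j / n) =
        ((if b then 1 else -1) - (if c then 1 else -1)) / n := by ring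
    rw [e1, abs_div, Nat.abs_cast]
    gcongr
    cases b <;> cases c <;> norm_num
  calc _ ≤ β / 2 * (2 / n) := by gcongr
    _ = β / n := by ring

/-! ### Algebra of the transition operator -/

lemma siteStep_mono {β : ℝ} (hβ0 : 0 ≤ β) (hβ1 : β < 1) {n : ℕ} (i : Fin n)
    {g h : Config n → ℝ} (hgh : ∀ σ, g σ ≤ h σ) (σ : Config n) :
    siteStep β i g σ ≤ siteStep β i h σ := by
  obtain ⟨h1, h2⟩ := plusProb_mem hβ0 hβ1 σ i
  exact add_le_add (mul_le_mul_of_nonneg_left (hgh _) (by linarith))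
    (mul_le_mul_of_nonneg_left (hgh _) (by linarith))

lemma step_mono {β : ℝ} (hβ0 : 0 ≤ β) (hβ1 : β < 1) {n : ℕ}
    {g h : Config n → ℝ} (hgh : ∀ σ, g σ ≤ h σ) (σ : Config n) :
    step β g σ ≤ step β h σ :=
  mul_le_mul_of_nonneg_left (Finset.sum_le_sum fun i _ => siteStep_mono hβ0 hβ1 i hgh σ)
    (by positivity)

lemma step_add (β : ℝ) {n : ℕ} (g h : Config n → ℝ) (σ : Config n) :
    step β (fun τ => g τ + h τ) σ = step β g σ + step β h σ := by
  simp only [step, ← mul_add, ← Finset.sum_add_distrib, siteStep]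
  congr 1
  exact Finset.sum_congr rfl fun i _ => by ring

lemma step_const_mul (β : ℝ) {n : ℕ} (c : ℝ) (g : Config n → ℝ) (σ : Config n) :
    step β (fun τ => c * g τ) σ = c * step β g σ := by
  simp only [step, siteStep, Finset.mul_sum]
  exact Finset.sum_congr rfl fun i _ => by ring

lemma step_const (β : ℝ) {n : ℕ} (hn : 0 < n) (c : ℝ) (σ : Config n) :
    step β (fun _ => c) σ = c := by
  have : (n : ℝ) ≠ 0 := by positivity
  have e : ∀ i, siteStep β i (fun _ => c) σ = c := fun i => by simp only [siteStep]; ring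
  simp only [step, e, Finset.sum_const, Finset.card_univ, Fintype.card_fin, nsmul_eq_mul]
  field_simp

lemma step_sub (β : ℝ) {n : ℕ} (g h : Config n → ℝ) (σ : Config n) :
    step β (fun τ => g τ - h τ) σ = step β g σ - step β h σ := by
  have e : (fun τ => g τ - h τ) = fun τ => g τ + (-1) * h τ := by funext τ; ring
  rw [e, step_add β g (fun τ => (-1) * h τ), step_const_mul]
  ring

lemma step_iterate_mono {β : ℝ} (hβ0 : 0 ≤ β) (hβ1 : β < 1) {n : ℕ} (t : ℕ)
    {g h : Config n → ℝ} (hgh : ∀ σ, g σ ≤ h σ) (σ : Config n) :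
    (step β)^[t] g σ ≤ (step β)^[t] h σ := by
  induction t generalizing g h with
  | zero => exact hgh σ
  | succ t ih =>
    rw [Function.iterate_succ_apply, Function.iterate_succ_apply]
    exact ih (step_mono hβ0 hβ1 hgh)

lemma step_iterate_const (β : ℝ) {n : ℕ} (hn : 0 < n) (t : ℕ) (c : ℝ) :
    (step β)^[t] (fun _ : Config n => c) = fun _ => c :=
  Function.iterate_fixed (funext fun σ => step_const β hn c σ) t

lemma sum_agree_off {n : ℕ} (σ : Config n) (i : Fin n) (F : Config n → ℝ) :
    (∑ η : Config n, if ∀ j, j ≠ i → η j = σ j then F η else 0) =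
      F (Function.update σ i true) + F (Function.update σ i false) := by
  have hne : Function.update σ i true ≠ Function.update σ i false := fun h => by
    simpa using congrFun h i
  rw [← Finset.sum_filter, ← Finset.sum_pair hne]
  refine Finset.sum_congr ?_ fun _ _ => rfl
  ext η
  simp only [Finset.mem_filter, Finset.mem_univ, true_and, Finset.mem_insert,
    Finset.mem_singleton, Function.eq_update_iff]
  cases η i <;> simp

lemma sum_glauberKernel_mul (β : ℝ) {n : ℕ} (g : Config n → ℝ) (σ : Config n) :
    ∑ η, glauberKernel β n σ η * g η = step β g σ := by
  simp only [glauberKernel, step, mul_assoc, Finset.sum_mul]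
  rw [← Finset.mul_sum, Finset.sum_comm]
  congr 1
  refine Finset.sum_congr rfl fun i _ => ?_
  simp only [ite_mul, zero_mul]
  rw [sum_agree_off σ i (fun η => if η i then pPlus β (mag σ - spin σ i / n) * g η
    else (1 - pPlus β (mag σ - spin σ i / n)) * g η)]
  simp [siteStep, plusProb]

lemma sum_glauberLaw_mul (β : ℝ) {n : ℕ} (t : ℕ) (g : Config n → ℝ) (σ : Config n) :
    ∑ η, glauberLaw β n t σ η * g η = (step β)^[t] g σ := by
  induction t generalizing g with
  | zero => simp [glauberLaw]
  | succ t ih =>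
    simp only [glauberLaw, Finset.sum_mul]
    rw [Finset.sum_comm, Function.iterate_succ_apply, ← ih]
    refine Finset.sum_congr rfl fun τ _ => ?_
    rw [← sum_glauberKernel_mul, Finset.mul_sum]
    exact Finset.sum_congr rfl fun η _ => by ring

lemma glauberLaw_eq_iterate (β : ℝ) {n : ℕ} (t : ℕ) (σ η : Config n) :
    glauberLaw β n t σ η = (step β)^[t] (fun τ => if τ = η then 1 else 0) σ := by
  rw [← sum_glauberLaw_mul]
  simp

lemma glauberLaw_nonneg {β : ℝ} (hβ0 : 0 ≤ β) (hβ1 : β < 1) {n : ℕ} (hn : 0 < n) (t : ℕ)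
    (σ η : Config n) : 0 ≤ glauberLaw β n t σ η := by
  have h := step_iterate_mono hβ0 hβ1 t (g := fun _ : Config n => (0 : ℝ))
    (h := fun τ => if τ = η then 1 else 0) (fun τ => by split_ifs <;> norm_num) σ
  rwa [step_iterate_const β hn, ← glauberLaw_eq_iterate] at h

lemma sum_glauberLaw (β : ℝ) {n : ℕ} (hn : 0 < n) (t : ℕ) (σ : Config n) :
    ∑ η, glauberLaw β n t σ η = 1 := by
  have h := sum_glauberLaw_mul β t (fun _ : Config n => (1 : ℝ)) σ
  rw [step_iterate_const β hn] at h
  simpa using h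

/-! ### Permutation symmetry -/

lemma spin_comp {n : ℕ} (ρ : Equiv.Perm (Fin n)) (σ : Config n) (i : Fin n) :
    spin (σ ∘ ρ) i = spin σ (ρ i) := rfl

lemma mag_comp {n : ℕ} (ρ : Equiv.Perm (Fin n)) (σ : Config n) : mag (σ ∘ ρ) = mag σ := by
  simp only [mag, spin_comp]
  rw [Equiv.sum_comp ρ (fun i => spin σ i)]

lemma plusProb_comp (β : ℝ) {n : ℕ} (ρ : Equiv.Perm (Fin n)) (σ : Config n) (i : Fin n) :
    plusProb β (σ ∘ ρ) i = plusProb β σ (ρ i) := by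
  simp only [plusProb, spin_comp, mag_comp]

lemma update_comp_perm {n : ℕ} (ρ : Equiv.Perm (Fin n)) (σ : Config n) (i : Fin n) (b : Bool) :
    Function.update (σ ∘ ρ) i b = Function.update σ (ρ i) b ∘ ρ :=
  (Function.update_comp_eq_of_injective σ ρ.injective i b).symm

lemma step_comp_perm (β : ℝ) {n : ℕ} (ρ : Equiv.Perm (Fin n)) {g h : Config n → ℝ}
    (hgh : ∀ σ, g (σ ∘ ρ) = h σ) (σ : Config n) : step β g (σ ∘ ρ) = step β h σ := by
  have e : ∀ i, siteStep β i g (σ ∘ ρ) = siteStep β (ρ i) h σ := fun i => by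
    simp only [siteStep, plusProb_comp, update_comp_perm, hgh]
  simp only [step, e]
  rw [Equiv.sum_comp ρ (fun i => siteStep β i h σ)]

lemma step_iterate_comp_perm (β : ℝ) {n : ℕ} (ρ : Equiv.Perm (Fin n)) (t : ℕ)
    {g h : Config n → ℝ} (hgh : ∀ σ, g (σ ∘ ρ) = h σ) (σ : Config n) :
    (step β)^[t] g (σ ∘ ρ) = (step β)^[t] h σ := by
  induction t generalizing g h with
  | zero => exact hgh σ
  | succ t ih =>
    rw [Function.iterate_succ_apply, Function.iterate_succ_apply]
    exact ih (step_comp_perm β ρ hgh)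

lemma glauberLaw_comp_perm (β : ℝ) {n : ℕ} (ρ : Equiv.Perm (Fin n)) (t : ℕ)
    (σ η : Config n) : glauberLaw β n t (σ ∘ ρ) (η ∘ ρ) = glauberLaw β n t σ η := by
  rw [glauberLaw_eq_iterate, glauberLaw_eq_iterate]
  refine step_iterate_comp_perm β ρ t (fun τ => ?_) σ
  have : τ ∘ ρ = η ∘ ρ ↔ τ = η := ρ.surjective.injective_comp_right.eq_iff
  simp only [this]

/-! ### The Gibbs measure -/

lemma cwExponent_eq (β : ℝ) {n : ℕ} (σ : Config n) :
    cwExponent β σ = β / n * (((∑ i, spin σ i) ^ 2 - n) / 2) := by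
  have h : (∑ i, spin σ i) ^ 2 =
      2 * (∑ i : Fin n, ∑ j : Fin n, if i < j then spin σ i * spin σ j else 0) + n := by
    have hs : (∑ i : Fin n, ∑ j : Fin n, if j < i then spin σ i * spin σ j else 0) =
        ∑ i : Fin n, ∑ j : Fin n, if i < j then spin σ i * spin σ j else 0 := by
      rw [Finset.sum_comm]
      exact Finset.sum_congr rfl fun i _ => Finset.sum_congr rfl fun j _ => by
        rw [mul_comm]
    have hd : (∑ i : Fin n, ∑ j : Fin n, if i = j then spin σ i * spin σ j else 0) = n := by
      simp [← sq, spin_sq]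
    rw [two_mul]
    nth_rewrite 2 [← hs]
    rw [← hd, sq, Finset.sum_mul_sum, ← Finset.sum_add_distrib, ← Finset.sum_add_distrib]
    refine Finset.sum_congr rfl fun i _ => ?_
    rw [← Finset.sum_add_distrib, ← Finset.sum_add_distrib]
    refine Finset.sum_congr rfl fun j _ => ?_
    rcases lt_trichotomy i j with hij | hij | hij
    · simp [hij, hij.not_gt, hij.ne]
    · simp [hij]
    · simp [hij, hij.not_gt, hij.ne']
  rw [cwExponent, h]
  ring

lemma cwExponent_comp_perm (β : ℝ) {n : ℕ} (ρ : Equiv.Perm (Fin n)) (σ : Config n) :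
    cwExponent β (σ ∘ ρ) = cwExponent β σ := by
  rw [cwExponent_eq, cwExponent_eq]
  simp only [spin_comp]
  rw [Equiv.sum_comp ρ (fun i => spin σ i)]

lemma cwMeasure_comp_perm (β : ℝ) {n : ℕ} (ρ : Equiv.Perm (Fin n)) (σ : Config n) :
    cwMeasure β n (σ ∘ ρ) = cwMeasure β n σ := by
  rw [cwMeasure, cwMeasure, cwExponent_comp_perm]

lemma sum_exp_pos (β : ℝ) (n : ℕ) : 0 < ∑ η : Config n, Real.exp (cwExponent β η) :=
  Finset.sum_pos (fun _ _ => Real.exp_pos _) Finset.univ_nonempty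

lemma cwMeasure_nonneg (β : ℝ) {n : ℕ} (σ : Config n) : 0 ≤ cwMeasure β n σ :=
  div_nonneg (Real.exp_pos _).le (sum_exp_pos β n).le

lemma sum_cwMeasure (β : ℝ) (n : ℕ) : ∑ σ, cwMeasure β n σ = 1 := by
  simp only [cwMeasure]
  rw [← Finset.sum_div, div_self (sum_exp_pos β n).ne']

lemma sum_spin_update {n : ℕ} (σ : Config n) (i : Fin n) (b : Bool) :
    ∑ j, spin (Function.update σ i b) j =
      (if b then 1 else -1) + ∑ j ∈ Finset.univ.erase i, spin σ j := by
  rw [← Finset.add_sum_erase _ _ (Finset.mem_univ i), spin_update_self]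
  congr 1
  exact Finset.sum_congr rfl fun j hj => spin_update_of_ne σ (Finset.ne_of_mem_erase hj) b

/-- Single-site conditional probabilities of the Gibbs measure. -/
lemma cwMeasure_update_true (β : ℝ) {n : ℕ} (σ : Config n) (i : Fin n) :
    cwMeasure β n (Function.update σ i true) = plusProb β σ i *
      (cwMeasure β n (Function.update σ i true) + cwMeasure β n (Function.update σ i false)) := by
  have hm := mag_sub_spin σ i
  have key : cwExponent β (Function.update σ i true) =
      2 * β * (mag σ - spin σ i / n) + cwExponent β (Function.update σ i false) := by
    rw [cwExponent_eq, cwExponent_eq, sum_spin_update, sum_spin_update, hm]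
    simp only [if_true, Bool.false_eq_true, if_false]
    ring
  rw [plusProb, pPlus_eq_exp, cwMeasure, cwMeasure, key, Real.exp_add]
  have := Real.exp_pos (2 * β * (mag σ - spin σ i / n))
  have := sum_exp_pos β n
  field_simp

lemma sum_update_eq {n : ℕ} (i : Fin n) (F : Config n → ℝ) :
    ∑ σ, (F (Function.update σ i true) + F (Function.update σ i false)) = 2 * ∑ σ, F σ := by
  have e : ∀ σ : Config n, F (Function.update σ i true) + F (Function.update σ i false) =
      F σ + F (Function.update σ i (!σ i)) := by
    intro σ
    have h := Function.update_eq_self i σ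
    cases hb : σ i
    · rw [hb] at h
      simp only [h, Bool.not_false]
      ring
    · rw [hb] at h
      simp only [h, Bool.not_true]
  have hinv : Function.Involutive fun σ : Config n => Function.update σ i (!σ i) := by
    intro σ
    simp
  have hc : ∑ σ, F (Function.update σ i (!σ i)) = ∑ σ, F σ := Equiv.sum_comp hinv.toPerm F
  rw [Finset.sum_congr rfl fun σ _ => e σ, Finset.sum_add_distrib, hc, two_mul]

lemma sum_cwMeasure_mul_siteStep (β : ℝ) {n : ℕ} (i : Fin n) (g : Config n → ℝ) :
    ∑ σ, cwMeasure β n σ * siteStep β i g σ = ∑ σ, cwMeasure β n σ * g σ := by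
  have h1 := sum_update_eq i fun σ => cwMeasure β n σ * siteStep β i g σ
  have h2 := sum_update_eq i fun σ => cwMeasure β n σ * g σ
  have : ∀ σ : Config n,
      cwMeasure β n (Function.update σ i true) * siteStep β i g (Function.update σ i true) +
        cwMeasure β n (Function.update σ i false) * siteStep β i g (Function.update σ i false) =
      cwMeasure β n (Function.update σ i true) * g (Function.update σ i true) +
        cwMeasure β n (Function.update σ i false) * g (Function.update σ i false) := by
    intro σ
    have h := cwMeasure_update_true β σ i
    simp only [siteStep, plusProb_update_self, Function.update_idem]
    linear_combination (g (Function.update σ i false) - g (Function.update σ i true)) * h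
  rw [Finset.sum_congr rfl fun σ _ => this σ] at h1
  linarith

lemma sum_cwMeasure_mul_step (β : ℝ) {n : ℕ} (hn : 0 < n) (g : Config n → ℝ) :
    ∑ σ, cwMeasure β n σ * step β g σ = ∑ σ, cwMeasure β n σ * g σ := by
  have hn' : (n : ℝ) ≠ 0 := by positivity
  have e : ∀ σ : Config n, cwMeasure β n σ * step β g σ =
      (1 / n) * ∑ i, cwMeasure β n σ * siteStep β i g σ := fun σ => by
    rw [step, ← Finset.mul_sum]; ring
  rw [Finset.sum_congr rfl fun σ _ => e σ, ← Finset.mul_sum, Finset.sum_comm,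
    Finset.sum_congr rfl fun i _ => sum_cwMeasure_mul_siteStep β i g]
  simp only [Finset.sum_const, Finset.card_univ, Fintype.card_fin, nsmul_eq_mul]
  field_simp

lemma sum_cwMeasure_mul_step_iterate (β : ℝ) {n : ℕ} (hn : 0 < n) (t : ℕ)
    (g : Config n → ℝ) :
    ∑ σ, cwMeasure β n σ * (step β)^[t] g σ = ∑ σ, cwMeasure β n σ * g σ := by
  induction t with
  | zero => rfl
  | succ t ih => rw [Function.iterate_succ_apply', sum_cwMeasure_mul_step β hn, ih]

/-! ### Propagation of discrete gradients -/

lemma discDeriv_step (β : ℝ) {n : ℕ} (g : Config n → ℝ) (i : Fin n) (σ : Config n) :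
    discDeriv (step β g) i σ =
      (1 / n) * ∑ j ∈ Finset.univ.erase i, discDeriv (siteStep β j g) i σ := by
  have hi : discDeriv (siteStep β i g) i σ = 0 := by
    simp [discDeriv, siteStep, plusProb_update_self]
  rw [Finset.sum_erase (f := fun j => discDeriv (siteStep β j g) i σ) _ hi]
  simp only [discDeriv, step, Finset.sum_sub_distrib, mul_sub]

lemma discDeriv_siteStep (β : ℝ) {n : ℕ} (g : Config n → ℝ) {i j : Fin n} (h : j ≠ i)
    (σ : Config n) (b : Bool) :
    discDeriv (siteStep β j g) i σ =
      plusProb β (Function.update σ i (!b)) j * discDeriv g i (Function.update σ j true) +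
      (1 - plusProb β (Function.update σ i (!b)) j) *
        discDeriv g i (Function.update σ j false) +
      (plusProb β (Function.update σ i true) j - plusProb β (Function.update σ i false) j) *
        discDeriv g j (Function.update σ i b) := by
  cases b <;>
  · simp only [discDeriv, siteStep, Function.update_comm h, Bool.not_true, Bool.not_false]
    ring

lemma abs_discDeriv_step_le {β : ℝ} (hβ0 : 0 ≤ β) (hβ1 : β < 1) {n : ℕ}
    {g : Config n → ℝ} {L : Fin n → ℝ} (hL : ∀ i σ, |discDeriv g i σ| ≤ L i)
    (i : Fin n) (σ : Config n) :
    |discDeriv (step β g) i σ| ≤ (1 - 1 / n) * L i + β / n ^ 2 * ∑ j, L j := by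
  have hn : 0 < n := i.pos
  have hn' : (0 : ℝ) < n := by positivity
  have hLn : ∀ j, 0 ≤ L j := fun j => (abs_nonneg _).trans (hL j σ)
  have hterm : ∀ j ∈ Finset.univ.erase i,
      |discDeriv (siteStep β j g) i σ| ≤ L i + β / n * L j := by
    intro j hj
    have hne := Finset.ne_of_mem_erase hj
    rw [discDeriv_siteStep β g hne σ true]
    obtain ⟨h1, h2⟩ := plusProb_mem hβ0 hβ1 (Function.update σ i (!true)) j
    have h3 := abs_plusProb_update_sub_le hβ0 σ hne true false
    refine (abs_add_le _ _).trans (add_le_add ((abs_add_le _ _).trans ?_) ?_)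
    · rw [abs_mul, abs_mul, abs_of_nonneg (show 0 ≤ plusProb β _ j by linarith),
        abs_of_nonneg (show 0 ≤ 1 - plusProb β _ j by linarith)]
      have := hL i (Function.update σ j true)
      have := hL i (Function.update σ j false)
      nlinarith
    · rw [abs_mul]
      exact mul_le_mul h3 (hL _ _) (abs_nonneg _) (by positivity)
  rw [discDeriv_step, abs_mul, abs_of_nonneg (by positivity : (0 : ℝ) ≤ 1 / n)]
  have hsum : |∑ j ∈ Finset.univ.erase i, discDeriv (siteStep β j g) i σ| ≤
      (n - 1) * L i + β / n * ∑ j, L j := by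
    refine (Finset.abs_sum_le_sum_abs _ _).trans ((Finset.sum_le_sum hterm).trans ?_)
    rw [Finset.sum_add_distrib, ← Finset.mul_sum, Finset.sum_const,
      Finset.card_erase_of_mem (Finset.mem_univ _), Finset.card_univ, Fintype.card_fin,
      nsmul_eq_mul, Nat.cast_sub (by omega), Nat.cast_one]
    gcongr
    · exact fun k _ _ => hLn k
    · exact Finset.erase_subset _ _
  calc _ ≤ 1 / (n : ℝ) * ((n - 1) * L i + β / n * ∑ j, L j) := by gcongr
    _ = _ := by field_simp

/-- The `ℓ¹` norm of coordinatewise Lipschitz constants contracts at rate `1 - (1 - β) / n`. -/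
lemma exists_discDeriv_bound_iterate {β : ℝ} (hβ0 : 0 ≤ β) (hβ1 : β < 1) {n : ℕ}
    (hn : 0 < n) {g : Config n → ℝ} {L : Fin n → ℝ}
    (hL : ∀ i σ, |discDeriv g i σ| ≤ L i) (t : ℕ) :
    ∃ L' : Fin n → ℝ, (∀ i σ, |discDeriv ((step β)^[t] g) i σ| ≤ L' i) ∧
      ∑ i, L' i = (1 - (1 - β) / n) ^ t * ∑ i, L i := by
  have hn' : (n : ℝ) ≠ 0 := by positivity
  induction t with
  | zero => exact ⟨L, hL, by simp⟩
  | succ t ih =>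
    obtain ⟨L', h1, h2⟩ := ih
    refine ⟨fun i => (1 - 1 / n) * L' i + β / n ^ 2 * ∑ j, L' j, fun i σ => ?_, ?_⟩
    · rw [Function.iterate_succ_apply']
      exact abs_discDeriv_step_le hβ0 hβ1 h1 i σ
    · rw [Finset.sum_add_distrib, ← Finset.mul_sum, Finset.sum_const, Finset.card_univ,
        Fintype.card_fin, nsmul_eq_mul, h2, pow_succ _ t]
      generalize (1 - (1 - β) / n) ^ t = r
      field_simp
      ring

lemma abs_discDeriv_iterate_le_const {β : ℝ} (hβ0 : 0 ≤ β) (hβ1 : β < 1) {n : ℕ}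
    {g : Config n → ℝ} {c : ℝ} (hc : ∀ i σ, |discDeriv g i σ| ≤ c) (t : ℕ)
    (i : Fin n) (σ : Config n) :
    |discDeriv ((step β)^[t] g) i σ| ≤ (1 - (1 - β) / n) ^ t * c := by
  have hn' : (n : ℝ) ≠ 0 := by have := i.pos; positivity
  induction t generalizing i σ with
  | zero => simpa using hc i σ
  | succ t ih =>
    rw [Function.iterate_succ_apply']
    refine (abs_discDeriv_step_le hβ0 hβ1 (L := fun _ => (1 - (1 - β) / n) ^ t * c) ih i σ).trans
      (le_of_eq ?_)
    rw [Finset.sum_const, Finset.card_univ, Fintype.card_fin, nsmul_eq_mul, pow_succ _ t]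
    generalize (1 - (1 - β) / n) ^ t = r
    field_simp
    ring

lemma abs_sub_le_sum_discDeriv_bound {n : ℕ} {g : Config n → ℝ} {L : Fin n → ℝ}
    (hL : ∀ i σ, |discDeriv g i σ| ≤ L i) (σ η : Config n) : |g η - g σ| ≤ ∑ i, L i := by
  have hupd : ∀ (i : Fin n) (τ : Config n) (b : Bool),
      |g (Function.update τ i b) - g τ| ≤ L i := by
    intro i τ b
    have h := hL i τ
    have h0 : 0 ≤ L i := (abs_nonneg _).trans h
    have hτ := Function.update_eq_self i τ
    unfold discDeriv at h
    cases hb : τ i <;> rw [hb] at hτ <;> rw [hτ] at h <;> cases b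
    · rw [hτ, sub_self, abs_zero]; exact h0
    · exact h
    · rwa [abs_sub_comm]
    · rw [hτ, sub_self, abs_zero]; exact h0
  have key : ∀ s : Finset (Fin n), |g (s.piecewise η σ) - g σ| ≤ ∑ i ∈ s, L i := by
    intro s
    induction s using Finset.induction_on with
    | empty => simp
    | insert i s his ih =>
      rw [Finset.sum_insert his, Finset.piecewise_insert]
      have := hupd i (s.piecewise η σ) (η i)
      exact (abs_sub_le _ (g (s.piecewise η σ)) _).trans (add_le_add this ih)
  simpa using key Finset.univ

/-! ### Variance of one step -/

/-- Probability that an update of site `i` flips its spin. -/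
def flipProb (β : ℝ) {n : ℕ} (σ : Config n) (i : Fin n) : ℝ :=
  if σ i then 1 - plusProb β σ i else plusProb β σ i

lemma flipProb_mem {β : ℝ} (hβ0 : 0 ≤ β) (hβ1 : β < 1) {n : ℕ} (σ : Config n) (i : Fin n) :
    1 / 10 ≤ flipProb β σ i ∧ flipProb β σ i ≤ 9 / 10 := by
  obtain ⟨h1, h2⟩ := plusProb_mem hβ0 hβ1 σ i
  unfold flipProb
  split_ifs <;> constructor <;> linarith

lemma siteStep_eq_flip (β : ℝ) {n : ℕ} (g : Config n → ℝ) (σ : Config n) (i : Fin n) :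
    siteStep β i g σ = g σ + flipProb β σ i * (g (Function.update σ i (!σ i)) - g σ) := by
  have hτ := Function.update_eq_self i σ
  cases hb : σ i <;> rw [hb] at hτ <;> simp [siteStep, flipProb, hb, hτ] <;> ring

lemma sq_flip_sub (n : ℕ) (g : Config n → ℝ) (σ : Config n) (i : Fin n) :
    (g (Function.update σ i (!σ i)) - g σ) ^ 2 = discDeriv g i σ ^ 2 := by
  have hτ := Function.update_eq_self i σ
  cases hb : σ i <;> rw [hb] at hτ <;> simp [discDeriv, hτ]
  ring

/-- One-step variance `P(g²) - (Pg)²`. -/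
def stepVar (β : ℝ) {n : ℕ} (g : Config n → ℝ) (σ : Config n) : ℝ :=
  step β (fun τ => g τ ^ 2) σ - step β g σ ^ 2

lemma stepVar_eq (β : ℝ) {n : ℕ} (hn : 0 < n) (g : Config n → ℝ) (σ : Config n) :
    stepVar β g σ = (1 / n) * ∑ i, flipProb β σ i * discDeriv g i σ ^ 2 -
      ((1 / n) * ∑ i, flipProb β σ i * (g (Function.update σ i (!σ i)) - g σ)) ^ 2 := by
  have hn' : (n : ℝ) ≠ 0 := by positivity
  have h1 : step β g σ = g σ +
      (1 / n) * ∑ i, flipProb β σ i * (g (Function.update σ i (!σ i)) - g σ) := by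
    simp only [step, siteStep_eq_flip, Finset.sum_add_distrib, Finset.sum_const,
      Finset.card_univ, Fintype.card_fin, nsmul_eq_mul]
    field_simp
  have h2 : step β (fun τ => g τ ^ 2) σ = g σ ^ 2 + 2 * g σ *
      ((1 / n) * ∑ i, flipProb β σ i * (g (Function.update σ i (!σ i)) - g σ)) +
      (1 / n) * ∑ i, flipProb β σ i * discDeriv g i σ ^ 2 := by
    have e : ∀ i, siteStep β i (fun τ => g τ ^ 2) σ = g σ ^ 2 +
        (2 * g σ * (flipProb β σ i * (g (Function.update σ i (!σ i)) - g σ)) +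
          flipProb β σ i * discDeriv g i σ ^ 2) := fun i => by
      rw [siteStep_eq_flip, ← sq_flip_sub]; ring
    simp only [step, e, Finset.sum_add_distrib, Finset.sum_const,
      Finset.card_univ, Fintype.card_fin, nsmul_eq_mul, ← Finset.mul_sum]
    field_simp
    ring
  rw [stepVar, h1, h2]
  ring

lemma stepVar_le {β : ℝ} (hβ0 : 0 ≤ β) (hβ1 : β < 1) {n : ℕ} (hn : 0 < n)
    {g : Config n → ℝ} {c : ℝ} (hc : ∀ i σ, |discDeriv g i σ| ≤ c) (σ : Config n) :
    stepVar β g σ ≤ c ^ 2 := by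
  have hn' : (n : ℝ) ≠ 0 := by positivity
  rw [stepVar_eq β hn]
  have h1 : ∑ i, flipProb β σ i * discDeriv g i σ ^ 2 ≤ ∑ _i : Fin n, c ^ 2 := by
    refine Finset.sum_le_sum fun i _ => ?_
    obtain ⟨h1, h2⟩ := flipProb_mem hβ0 hβ1 σ i
    have h3 : discDeriv g i σ ^ 2 ≤ c ^ 2 :=
      sq_le_sq' (abs_le.1 (hc i σ)).1 (abs_le.1 (hc i σ)).2
    nlinarith [sq_nonneg (discDeriv g i σ)]
  have h2 : (1 / (n : ℝ)) * ∑ i, flipProb β σ i * discDeriv g i σ ^ 2 ≤ c ^ 2 := by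
    calc _ ≤ (1 / (n : ℝ)) * ∑ _i : Fin n, c ^ 2 := by gcongr
      _ = c ^ 2 := by
        simp only [Finset.sum_const, Finset.card_univ, Fintype.card_fin, nsmul_eq_mul]
        field_simp
  linarith [sq_nonneg ((1 / (n : ℝ)) *
    ∑ i, flipProb β σ i * (g (Function.update σ i (!σ i)) - g σ))]

lemma gradSq_le_stepVar {β : ℝ} (hβ0 : 0 ≤ β) (hβ1 : β < 1) {n : ℕ} (hn : 0 < n)
    (g : Config n → ℝ) (σ : Config n) :
    1 / (100 * n) * gradSq g σ ≤ stepVar β g σ := by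
  have hn' : (0 : ℝ) < n := by positivity
  rw [stepVar_eq β hn]
  set S := ∑ i, flipProb β σ i * discDeriv g i σ ^ 2 with hS
  have h1 : 1 / 10 * gradSq g σ ≤ S := by
    rw [hS, gradSq, Finset.mul_sum]
    refine Finset.sum_le_sum fun i _ => ?_
    exact mul_le_mul_of_nonneg_right (flipProb_mem hβ0 hβ1 σ i).1 (sq_nonneg _)
  have h2 : (∑ i, flipProb β σ i * (g (Function.update σ i (!σ i)) - g σ)) ^ 2 ≤
      n * (9 / 10 * S) := by
    refine sq_sum_le_card_mul_sum_sq.trans ?_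
    rw [Finset.card_univ, Fintype.card_fin]
    gcongr
    rw [hS, Finset.mul_sum]
    refine Finset.sum_le_sum fun i _ => ?_
    obtain ⟨h3, h4⟩ := flipProb_mem hβ0 hβ1 σ i
    rw [mul_pow, sq_flip_sub, ← mul_assoc, sq (flipProb β σ i)]
    gcongr
  have h3 : ((1 / (n : ℝ)) *
      ∑ i, flipProb β σ i * (g (Function.update σ i (!σ i)) - g σ)) ^ 2 ≤
        1 / n * (9 / 10 * S) := by
    rw [mul_pow]
    calc _ ≤ (1 / (n : ℝ)) ^ 2 * (n * (9 / 10 * S)) := by gcongr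
      _ = _ := by field_simp
  have h4 : 1 / (100 * (n : ℝ)) * gradSq g σ ≤ 1 / n * (1 / 10 * S) := by
    calc 1 / (100 * (n : ℝ)) * gradSq g σ = 1 / n * (1 / 10 * (1 / 10 * gradSq g σ)) := by
          field_simp; ring
      _ ≤ _ := by gcongr
  linarith

/-- Variance of `g` after `t` steps. -/
def iterVar (β : ℝ) {n : ℕ} (t : ℕ) (g : Config n → ℝ) (σ : Config n) : ℝ :=
  (step β)^[t] (fun τ => g τ ^ 2) σ - (step β)^[t] g σ ^ 2

lemma iterVar_succ (β : ℝ) {n : ℕ} (t : ℕ) (g : Config n → ℝ) (σ : Config n) :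
    iterVar β (t + 1) g σ = step β (iterVar β t g) σ + stepVar β ((step β)^[t] g) σ := by
  have e : iterVar β t g =
      fun τ => (step β)^[t] (fun τ => g τ ^ 2) τ - (step β)^[t] g τ ^ 2 := rfl
  rw [e, step_sub, stepVar, iterVar, Function.iterate_succ_apply', Function.iterate_succ_apply']
  ring

/-! ### Reverse Poincaré inequality -/

lemma abs_discDeriv_siteStep_le {β : ℝ} (hβ0 : 0 ≤ β) (hβ1 : β < 1) {n : ℕ}
    (g : Config n → ℝ) {i j : Fin n} (h : j ≠ i) (σ : Config n) :
    |discDeriv (siteStep β j g) i σ| ≤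
      (1 + 10 / n) * siteStep β j (fun τ => |discDeriv g i τ|) σ +
        β / n * |discDeriv g j σ| := by
  have hn' : (0 : ℝ) < n := by have := i.pos; positivity
  have h0 := Function.update_eq_self i σ
  have hf := discDeriv_siteStep β g h σ (σ i)
  have hd := abs_plusProb_update_sub_le hβ0 σ h (!σ i) (σ i)
  have hδ := abs_plusProb_update_sub_le hβ0 σ h true false
  rw [h0] at hf hd
  obtain ⟨h1, h2⟩ := plusProb_mem hβ0 hβ1 (Function.update σ i (!σ i)) j
  obtain ⟨h3, h4⟩ := plusProb_mem hβ0 hβ1 σ j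
  set p' := plusProb β (Function.update σ i (!σ i)) j
  set p := plusProb β σ j with hp
  have hβn : β / n ≤ 1 / n := by gcongr
  obtain ⟨h5, h6⟩ := abs_le.1 hd
  have e10 : (10 : ℝ) / n = 10 * (1 / n) := by ring
  have hpos : (0 : ℝ) ≤ 1 / n := by positivity
  have hle1 : p' ≤ (1 + 10 / n) * p := by rw [e10]; nlinarith
  have hle2 : 1 - p' ≤ (1 + 10 / n) * (1 - p) := by rw [e10]; nlinarith
  rw [hf, siteStep, ← hp]
  refine (abs_add_le _ _).trans (add_le_add ((abs_add_le _ _).trans ?_) ?_)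
  · rw [abs_mul, abs_mul, abs_of_nonneg (by linarith : 0 ≤ p'),
      abs_of_nonneg (by linarith : 0 ≤ 1 - p'), mul_add, ← mul_assoc, ← mul_assoc]
    gcongr
  · rw [abs_mul]
    gcongr

/-- The squared gradient is almost contracted by one step of the dynamics. -/
lemma gradSq_step_le {β : ℝ} (hβ0 : 0 ≤ β) (hβ1 : β < 1) {n : ℕ} (hn : 0 < n)
    (g : Config n → ℝ) (σ : Config n) :
    gradSq (step β g) σ ≤ (1 + 10 / n) ^ 3 * step β (gradSq g) σ := by
  have hn' : (0 : ℝ) < n := by positivity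
  set A : Fin n → ℝ := fun i =>
    ∑ j ∈ Finset.univ.erase i, siteStep β j (fun τ => discDeriv g i τ ^ 2) σ with hA
  set B : ℝ := ∑ j, |discDeriv g j σ| with hB
  have hBsq : B ^ 2 ≤ n * gradSq g σ := by
    have h := sq_sum_le_card_mul_sum_sq (s := Finset.univ) (f := fun j => |discDeriv g j σ|)
    simpa [sq_abs, hB, gradSq] using h
  have hstep : step β (gradSq g) σ = (1 / n) * (∑ i, A i + gradSq g σ) := by
    have e : ∀ j, siteStep β j (gradSq g) σ =
        ∑ i, siteStep β j (fun τ => discDeriv g i τ ^ 2) σ := fun j => by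
      simp only [siteStep, gradSq, Finset.mul_sum, Finset.sum_add_distrib]
    simp only [step, e]
    rw [Finset.sum_comm]
    congr 1
    rw [hA, gradSq, ← Finset.sum_add_distrib]
    refine Finset.sum_congr rfl fun i _ => ?_
    rw [← Finset.sum_erase_add _ _ (Finset.mem_univ i)]
    congr 1
    simp only [siteStep, discDeriv_update]
    ring
  have hsite : ∀ i j, siteStep β j (fun τ => |discDeriv g i τ|) σ ^ 2 ≤
      siteStep β j (fun τ => discDeriv g i τ ^ 2) σ := by
    intro i j
    obtain ⟨h1, h2⟩ := plusProb_mem hβ0 hβ1 σ j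
    simp only [siteStep]
    rw [← sq_abs (discDeriv g i (Function.update σ j true)),
      ← sq_abs (discDeriv g i (Function.update σ j false))]
    generalize |discDeriv g i (Function.update σ j true)| = x
    generalize |discDeriv g i (Function.update σ j false)| = y
    have : 0 ≤ plusProb β σ j * (1 - plusProb β σ j) * (x - y) ^ 2 :=
      mul_nonneg (mul_nonneg (by linarith) (by linarith)) (sq_nonneg _)
    linarith
  have hterm : ∀ i, discDeriv (step β g) i σ ^ 2 ≤
      (1 + 1 / n) * (1 + 10 / n) ^ 2 * ((1 / n) * A i) +
        (1 + n) * (1 / n ^ 4 * B ^ 2) := by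
    intro i
    set Q : ℝ := (1 / n) *
      ∑ j ∈ Finset.univ.erase i, siteStep β j (fun τ => |discDeriv g i τ|) σ with hQ
    have hQsq : Q ^ 2 ≤ (1 / n) * A i := by
      have h1 : (∑ j ∈ Finset.univ.erase i, siteStep β j (fun τ => |discDeriv g i τ|) σ) ^ 2 ≤
          n * A i := by
        refine sq_sum_le_card_mul_sum_sq.trans ?_
        have hc : ((Finset.univ.erase i).card : ℝ) ≤ n := by
          have := Finset.card_le_univ (Finset.univ.erase i)
          rw [Fintype.card_fin] at this
          exact_mod_cast this
        exact mul_le_mul hc (Finset.sum_le_sum fun j _ => hsite i j)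
          (Finset.sum_nonneg fun j _ => sq_nonneg _) hn'.le
      rw [hQ, mul_pow]
      calc _ ≤ (1 / (n : ℝ)) ^ 2 * (n * A i) := by gcongr
        _ = _ := by field_simp
    have habs : |discDeriv (step β g) i σ| ≤ (1 + 10 / n) * Q + 1 / n ^ 2 * B := by
      rw [discDeriv_step, abs_mul, abs_of_nonneg (by positivity : (0 : ℝ) ≤ 1 / n)]
      have h1 : |∑ j ∈ Finset.univ.erase i, discDeriv (siteStep β j g) i σ| ≤
          (1 + 10 / n) * (∑ j ∈ Finset.univ.erase i,
            siteStep β j (fun τ => |discDeriv g i τ|) σ) + 1 / n * B := by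
        refine (Finset.abs_sum_le_sum_abs _ _).trans ((Finset.sum_le_sum fun j hj =>
          abs_discDeriv_siteStep_le hβ0 hβ1 g (Finset.ne_of_mem_erase hj) σ).trans ?_)
        rw [Finset.sum_add_distrib, ← Finset.mul_sum, ← Finset.mul_sum]
        gcongr
        exact Finset.sum_le_sum_of_subset_of_nonneg (Finset.erase_subset _ _)
          fun _ _ _ => abs_nonneg _
      calc _ ≤ 1 / (n : ℝ) * _ := mul_le_mul_of_nonneg_left h1 (by positivity)
        _ = _ := by rw [hQ]; ring
    calc discDeriv (step β g) i σ ^ 2 = |discDeriv (step β g) i σ| ^ 2 := (sq_abs _).symm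
      _ ≤ ((1 + 10 / n) * Q + 1 / n ^ 2 * B) ^ 2 := by gcongr
      _ ≤ (1 + 1 / n) * ((1 + 10 / n) * Q) ^ 2 + (1 + n) * (1 / n ^ 2 * B) ^ 2 := by
          generalize (1 + 10 / (n : ℝ)) * Q = x
          generalize 1 / (n : ℝ) ^ 2 * B = y
          have : 0 ≤ 1 / n * (x - n * y) ^ 2 := by positivity
          have e : 1 / n * (x - n * y) ^ 2 = 1 / n * x ^ 2 + n * y ^ 2 - 2 * (x * y) := by
            field_simp
            ring
          nlinarith
      _ = (1 + 1 / n) * (1 + 10 / n) ^ 2 * Q ^ 2 + (1 + n) * (1 / n ^ 4 * B ^ 2) := by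
          rw [mul_pow, mul_pow]; ring
      _ ≤ _ := by gcongr
  have hAn : 0 ≤ ∑ i, A i := Finset.sum_nonneg fun i _ => Finset.sum_nonneg fun j _ =>
    (sq_nonneg _).trans (hsite i j)
  have hGn : 0 ≤ gradSq g σ := Finset.sum_nonneg fun i _ => sq_nonneg _
  have h1n : (1 : ℝ) + 1 / n ≤ 1 + 10 / n := by gcongr; norm_num
  have h10 : (1 : ℝ) ≤ 1 + 10 / n := by have : (0 : ℝ) ≤ 10 / n := by positivity
                                        linarith
  calc gradSq (step β g) σ
      ≤ ∑ i, ((1 + 1 / n) * (1 + 10 / n) ^ 2 * ((1 / n) * A i) +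
          (1 + n) * (1 / n ^ 4 * B ^ 2)) := Finset.sum_le_sum fun i _ => hterm i
    _ = (1 + 1 / n) * (1 + 10 / n) ^ 2 * (1 / n * ∑ i, A i) +
          (1 + 1 / n) * (1 / n ^ 2 * B ^ 2) := by
        rw [Finset.sum_add_distrib, ← Finset.mul_sum, ← Finset.mul_sum, Finset.sum_const,
          Finset.card_univ, Fintype.card_fin, nsmul_eq_mul]
        field_simp
        ring
    _ ≤ (1 + 1 / n) * (1 + 10 / n) ^ 2 * (1 / n * ∑ i, A i) +
          (1 + 1 / n) * (1 / n ^ 2 * (n * gradSq g σ)) := by gcongr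
    _ = (1 + 1 / n) * ((1 + 10 / n) ^ 2 * (1 / n * ∑ i, A i) + 1 * (1 / n * gradSq g σ)) := by
        field_simp
    _ ≤ (1 + 10 / n) * ((1 + 10 / n) ^ 2 * (1 / n * ∑ i, A i) +
          (1 + 10 / n) ^ 2 * (1 / n * gradSq g σ)) := by
        gcongr
        exact one_le_pow₀ h10
    _ = (1 + 10 / n) ^ 3 * step β (gradSq g) σ := by
        rw [hstep]; ring

/-- Reverse Poincaré inequality for the iterated dynamics. -/
lemma gradSq_iterate_le_iterVar {β : ℝ} (hβ0 : 0 ≤ β) (hβ1 : β < 1) {n : ℕ} (hn : 0 < n)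
    (g : Config n → ℝ) (t : ℕ) (σ : Config n) :
    (t + 1) / (100 * n) * gradSq ((step β)^[t] g) σ ≤
      ((1 + 10 / n) ^ 3) ^ t * iterVar β (t + 1) g σ := by
  have hn' : (0 : ℝ) < n := by positivity
  set R : ℝ := (1 + 10 / n) ^ 3 with hR
  have hR1 : 1 ≤ R := one_le_pow₀ (by have : (0 : ℝ) ≤ 10 / n := by positivity
                                      linarith)
  induction t generalizing σ with
  | zero =>
    have h := gradSq_le_stepVar hβ0 hβ1 hn g σ
    have e : iterVar β 0 g = fun _ => 0 := by funext τ; simp [iterVar]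
    rw [iterVar_succ, e, step_const β hn, zero_add]
    simpa using h
  | succ t ih =>
    have h1 : step β (fun τ => (t + 1) / (100 * n) * gradSq ((step β)^[t] g) τ) σ ≤
        R ^ t * step β (iterVar β (t + 1) g) σ := by
      rw [← step_const_mul]
      exact step_mono hβ0 hβ1 ih σ
    rw [step_const_mul] at h1
    have h2 := gradSq_step_le hβ0 hβ1 hn ((step β)^[t] g) σ
    rw [← Function.iterate_succ_apply' (step β), ← hR] at h2
    have h3 := gradSq_le_stepVar hβ0 hβ1 hn ((step β)^[t + 1] g) σ
    have hRt : 1 ≤ R ^ (t + 1) := one_le_pow₀ hR1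
    have hG : 0 ≤ gradSq ((step β)^[t + 1] g) σ := Finset.sum_nonneg fun i _ => sq_nonneg _
    have hV : 0 ≤ stepVar β ((step β)^[t + 1] g) σ := le_trans (by positivity) h3
    rw [iterVar_succ, mul_add]
    calc ((t + 1 : ℕ) + 1 : ℝ) / (100 * n) * gradSq ((step β)^[t + 1] g) σ
        = (t + 1) / (100 * n) * gradSq ((step β)^[t + 1] g) σ +
          1 / (100 * n) * gradSq ((step β)^[t + 1] g) σ := by push_cast; ring
      _ ≤ (t + 1) / (100 * n) * (R * step β (gradSq ((step β)^[t] g)) σ) +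
          1 * stepVar β ((step β)^[t + 1] g) σ := by
        rw [one_mul]
        gcongr
      _ = R * ((t + 1) / (100 * n) * step β (gradSq ((step β)^[t] g)) σ) +
          1 * stepVar β ((step β)^[t + 1] g) σ := by ring
      _ ≤ R * (R ^ t * step β (iterVar β (t + 1) g) σ) +
          R ^ (t + 1) * stepVar β ((step β)^[t + 1] g) σ := by gcongr
      _ = _ := by ring

/-- After `n` steps any bounded observable has a bounded `ℓ²` gradient. -/
lemma gradSq_iterate_le {β : ℝ} (hβ0 : 0 ≤ β) (hβ1 : β < 1) {n : ℕ} (hn : 0 < n)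
    {f : Config n → ℝ} (hf : ∀ σ, |f σ| ≤ 1) (σ : Config n) :
    gradSq ((step β)^[n - 1] f) σ ≤ 100 * Real.exp 30 := by
  have hn' : (0 : ℝ) < n := by positivity
  have h := gradSq_iterate_le_iterVar hβ0 hβ1 hn f (n - 1) σ
  rw [Nat.sub_add_cancel hn] at h
  have e1 : ((n - 1 : ℕ) : ℝ) + 1 = n := by rw [Nat.cast_sub hn]; simp
  have e2 : (n : ℝ) / (100 * n) = 1 / 100 := by field_simp
  rw [e1, e2] at h
  have hV : iterVar β n f σ ≤ 1 := by
    have h1 := step_iterate_mono hβ0 hβ1 n (g := fun τ => f τ ^ 2) (h := fun _ => (1 : ℝ))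
      (fun τ => (sq_le_one_iff_abs_le_one _).2 (hf τ)) σ
    rw [step_iterate_const β hn] at h1
    rw [iterVar]
    linarith [sq_nonneg ((step β)^[n] f σ)]
  have hR : ((1 + 10 / (n : ℝ)) ^ 3) ^ (n - 1) ≤ Real.exp 30 := by
    have h1 : (1 : ℝ) ≤ 1 + 10 / n := by
      have : (0 : ℝ) ≤ 10 / n := by positivity
      linarith
    calc ((1 + 10 / (n : ℝ)) ^ 3) ^ (n - 1) ≤ ((1 + 10 / (n : ℝ)) ^ 3) ^ n :=
          pow_le_pow_right₀ (one_le_pow₀ h1) (Nat.sub_le _ _)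
      _ ≤ (Real.exp (10 / n) ^ 3) ^ n := by
          gcongr
          rw [add_comm]
          exact Real.add_one_le_exp _
      _ = Real.exp 30 := by
          rw [← Real.exp_nat_mul, ← Real.exp_nat_mul]
          congr 1
          push_cast
          field_simp
          norm_num
  have : ((1 + 10 / (n : ℝ)) ^ 3) ^ (n - 1) * iterVar β n f σ ≤ Real.exp 30 * 1 := by
    refine (mul_le_mul_of_nonneg_left hV (by positivity)).trans ?_
    gcongr
  linarith

/-! ### Observables invariant under the symmetries of a configuration -/

lemma discDeriv_update_eq_of_swap {n : ℕ} {g : Config n → ℝ} {i j : Fin n}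
    (hg : ∀ σ, g (σ ∘ Equiv.swap i j) = g σ) {τ : Config n} (h : τ i = τ j) :
    discDeriv g j τ = discDeriv g i τ := by
  have hτ : τ ∘ Equiv.swap i j = τ := by
    funext k
    rcases eq_or_ne k i with rfl | hki
    · simp [h]
    · rcases eq_or_ne k j with rfl | hkj
      · simp [h]
      · simp [Equiv.swap_apply_of_ne_of_ne hki hkj]
  have e : ∀ b, g (Function.update τ j b) = g (Function.update τ i b) := by
    intro b
    have h1 := update_comp_perm (Equiv.swap i j) τ i b
    rw [hτ, Equiv.swap_apply_left] at h1
    rw [h1, hg]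
  rw [discDeriv, discDeriv, e, e]

lemma abs_discDeriv_le_of_gradSq_le {n : ℕ} {g : Config n → ℝ} {K : ℝ} (σ₀ : Config n)
    (hg : ∀ i j, σ₀ i = σ₀ j → ∀ σ, g (σ ∘ Equiv.swap i j) = g σ)
    (hK : ∀ σ, gradSq g σ ≤ K) (i : Fin n) (σ : Config n) :
    |discDeriv g i σ| ≤ √(2 * K) * √(1 / ((Finset.univ.filter fun j => σ₀ j = σ₀ i).card)) := by
  set N := Finset.univ.filter fun j => σ₀ j = σ₀ i with hN
  have hNpos : (0 : ℝ) < N.card := by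
    have : 0 < N.card := Finset.card_pos.2 ⟨i, by simp [hN]⟩
    exact_mod_cast this
  have hb : ∀ b, ((N.filter fun j => σ j = b).card : ℝ) * discDeriv g i σ ^ 2 ≤ K := by
    intro b
    refine le_trans ?_ (hK (Function.update σ i b))
    rw [gradSq, ← nsmul_eq_mul, ← Finset.sum_const]
    calc ∑ _j ∈ N.filter fun j => σ j = b, discDeriv g i σ ^ 2
        = ∑ j ∈ N.filter fun j => σ j = b, discDeriv g j (Function.update σ i b) ^ 2 := by
          refine Finset.sum_congr rfl fun j hj => ?_
          rw [Finset.mem_filter, hN, Finset.mem_filter] at hj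
          rw [discDeriv_update_eq_of_swap (hg i j hj.1.2.symm), discDeriv_update]
          rcases eq_or_ne j i with rfl | hji
          · rfl
          · simp [hji, hj.2]
      _ ≤ _ := Finset.sum_le_sum_of_subset_of_nonneg (Finset.subset_univ _)
          fun _ _ _ => sq_nonneg _
  have hsum : ((N.filter fun j => σ j = true).card : ℝ) +
      (N.filter fun j => σ j = false).card = N.card := by
    have h := Finset.card_filter_add_card_filter_not (s := N) (fun j => σ j = true)
    simp only [Bool.not_eq_true] at h
    exact_mod_cast h
  have hmain : N.card * discDeriv g i σ ^ 2 ≤ 2 * K := by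
    rw [← hsum, add_mul]
    linarith [hb true, hb false]
  have hK0 : 0 ≤ 2 * K := le_trans (by positivity) hmain
  rw [← Real.sqrt_mul hK0]
  refine Real.abs_le_sqrt ?_
  rw [mul_one_div, le_div_iff₀ hNpos]
  linarith

lemma sum_sqrt_one_div_card_le {n : ℕ} (σ₀ : Config n) :
    ∑ i, √(1 / ((Finset.univ.filter fun j => σ₀ j = σ₀ i).card : ℝ)) ≤ √(2 * n) := by
  refine Real.le_sqrt_of_sq_le (sq_sum_le_card_mul_sum_sq.trans ?_)
  rw [Finset.card_univ, Fintype.card_fin, mul_comm]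
  gcongr
  have e : ∀ i : Fin n, √(1 / ((Finset.univ.filter fun j => σ₀ j = σ₀ i).card : ℝ)) ^ 2 =
      1 / ((Finset.univ.filter fun j => σ₀ j = σ₀ i).card : ℝ) := fun i =>
    Real.sq_sqrt (by positivity)
  rw [Finset.sum_congr rfl fun i _ => e i, ← Finset.sum_fiberwise Finset.univ σ₀]
  have hfib : ∀ b, ∑ i with σ₀ i = b,
      (1 : ℝ) / ((Finset.univ.filter fun j => σ₀ j = σ₀ i).card : ℝ) ≤ 1 := by
    intro b
    have : ∀ i ∈ Finset.univ.filter fun i => σ₀ i = b,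
        (1 : ℝ) / ((Finset.univ.filter fun j => σ₀ j = σ₀ i).card : ℝ) =
          1 / (Finset.univ.filter fun j => σ₀ j = b).card := fun i hi => by
      rw [(Finset.mem_filter.1 hi).2]
    rw [Finset.sum_congr rfl this, Finset.sum_const, nsmul_eq_mul, mul_one_div]
    exact div_self_le_one _
  rw [Fintype.sum_bool]
  linarith [hfib true, hfib false]

/-! ### Upper bound on the distance to equilibrium -/

lemma tvDist_eq_iterate (β : ℝ) {n : ℕ} (hn : 0 < n) (t : ℕ) (σ₀ : Config n)
    {f : Config n → ℝ}
    (hf : ∀ η, |glauberLaw β n t σ₀ η - cwMeasure β n η| =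
      (glauberLaw β n t σ₀ η - cwMeasure β n η) * f η) :
    tvDist (glauberLaw β n t σ₀) (cwMeasure β n) =
      (∑ η, cwMeasure β n η * ((step β)^[t] f σ₀ - (step β)^[t] f η)) / 2 := by
  rw [tvDist, Finset.sum_congr rfl fun η _ => hf η]
  congr 1
  simp only [sub_mul, mul_sub, Finset.sum_sub_distrib]
  rw [sum_glauberLaw_mul, sum_cwMeasure_mul_step_iterate β hn, ← Finset.sum_mul,
    sum_cwMeasure, one_mul]

lemma tvDist_glauberLaw_le {β : ℝ} (hβ0 : 0 ≤ β) (hβ1 : β < 1) {n : ℕ} (hn : 0 < n)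
    (t : ℕ) (σ₀ : Config n) :
    tvDist (glauberLaw β n (t + (n - 1)) σ₀) (cwMeasure β n) ≤
      (1 - (1 - β) / n) ^ t * (√(2 * (100 * Real.exp 30)) * √(2 * n)) / 2 := by
  set T := t + (n - 1) with hT
  set f : Config n → ℝ := fun η =>
    if cwMeasure β n η ≤ glauberLaw β n T σ₀ η then 1 else -1 with hf
  have hf1 : ∀ η, |f η| ≤ 1 := fun η => by
    simp only [hf]; split_ifs <;> simp
  have hfabs : ∀ η, |glauberLaw β n T σ₀ η - cwMeasure β n η| =
      (glauberLaw β n T σ₀ η - cwMeasure β n η) * f η := fun η => by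
    simp only [hf]
    split_ifs with h
    · rw [abs_of_nonneg (by linarith), mul_one]
    · rw [abs_of_neg (by linarith), mul_neg_one]
  have hfsymm : ∀ i j, σ₀ i = σ₀ j → ∀ σ, f (σ ∘ Equiv.swap i j) = f σ := by
    intro i j hij σ
    have hσ₀ : σ₀ ∘ Equiv.swap i j = σ₀ := by
      funext k
      rcases eq_or_ne k i with rfl | hki
      · simp [hij]
      · rcases eq_or_ne k j with rfl | hkj
        · simp [hij]
        · simp [Equiv.swap_apply_of_ne_of_ne hki hkj]
    have h1 := glauberLaw_comp_perm β (Equiv.swap i j) T σ₀ σ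
    rw [hσ₀] at h1
    simp only [hf, cwMeasure_comp_perm, h1]
  obtain ⟨L, hL, hLsum⟩ := exists_discDeriv_bound_iterate hβ0 hβ1 hn
    (g := (step β)^[n - 1] f)
    (L := fun i => √(2 * (100 * Real.exp 30)) *
      √(1 / ((Finset.univ.filter fun j => σ₀ j = σ₀ i).card)))
    (abs_discDeriv_le_of_gradSq_le σ₀
      (fun i j hij => step_iterate_comp_perm β _ _ (hfsymm i j hij))
      (gradSq_iterate_le hβ0 hβ1 hn hf1)) t
  rw [← Function.iterate_add_apply, ← hT] at hL
  have hρ : 0 ≤ 1 - (1 - β) / n := by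
    have h1 : (1 : ℝ) ≤ n := by exact_mod_cast hn
    have : (1 - β) / n ≤ 1 := div_le_one_of_le₀ (by linarith) (by linarith)
    linarith
  have hbound : ∑ i, L i ≤
      (1 - (1 - β) / n) ^ t * (√(2 * (100 * Real.exp 30)) * √(2 * n)) := by
    rw [hLsum, ← Finset.mul_sum]
    gcongr
    exact sum_sqrt_one_div_card_le σ₀
  rw [tvDist_eq_iterate β hn T σ₀ hfabs]
  gcongr
  calc ∑ η, cwMeasure β n η * ((step β)^[T] f σ₀ - (step β)^[T] f η)
      ≤ ∑ η, cwMeasure β n η * ∑ i, L i := by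
        gcongr with η
        · exact cwMeasure_nonneg β η
        · exact (le_abs_self _).trans (abs_sub_le_sum_discDeriv_bound hL η σ₀)
    _ = ∑ i, L i := by rw [← Finset.sum_mul, sum_cwMeasure, one_mul]
    _ ≤ _ := hbound

lemma tvDist_nonneg {Ω : Type*} [Fintype Ω] (μ ν : Ω → ℝ) : 0 ≤ tvDist μ ν :=
  div_nonneg (Finset.sum_nonneg fun _ _ => abs_nonneg _) zero_le_two

lemma tvDist_le_one {β : ℝ} (hβ0 : 0 ≤ β) (hβ1 : β < 1) {n : ℕ} (hn : 0 < n) (t : ℕ)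
    (σ : Config n) : tvDist (glauberLaw β n t σ) (cwMeasure β n) ≤ 1 := by
  have h : ∑ η, |glauberLaw β n t σ η - cwMeasure β n η| ≤
      ∑ η, (glauberLaw β n t σ η + cwMeasure β n η) := by
    refine Finset.sum_le_sum fun η _ => ?_
    have h1 := glauberLaw_nonneg hβ0 hβ1 hn t σ η
    have h2 := cwMeasure_nonneg β η
    rw [abs_le]
    constructor <;> linarith
  rw [Finset.sum_add_distrib, sum_glauberLaw β hn, sum_cwMeasure] at h
  rw [tvDist]
  linarith

lemma glauberDist_nonneg (β : ℝ) (n t : ℕ) : 0 ≤ glauberDist β n t :=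
  Real.iSup_nonneg fun _ => tvDist_nonneg _ _

lemma glauberDist_le_one {β : ℝ} (hβ0 : 0 ≤ β) (hβ1 : β < 1) {n : ℕ} (hn : 0 < n) (t : ℕ) :
    glauberDist β n t ≤ 1 :=
  ciSup_le fun σ => tvDist_le_one hβ0 hβ1 hn t σ

lemma tvDist_le_glauberDist (β : ℝ) (n t : ℕ) (σ : Config n) :
    tvDist (glauberLaw β n t σ) (cwMeasure β n) ≤ glauberDist β n t :=
  le_ciSup (f := fun σ : Config n => tvDist (glauberLaw β n t σ) (cwMeasure β n))
    (Set.finite_range _).bddAbove σ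

/-- Constant in the upper bound on the distance to equilibrium. -/
def upperConst : ℝ := √(2 * (100 * Real.exp 30)) * √2

lemma glauberDist_le_of_time_ge {β : ℝ} (hβ0 : 0 ≤ β) (hβ1 : β < 1) {n : ℕ} (hn : 0 < n)
    {γ : ℝ} {T : ℕ} (hγ : 1 ≤ γ)
    (hT : n * Real.log n / (2 * (1 - β)) + γ * n ≤ T) :
    glauberDist β n T ≤ upperConst * Real.exp (-(1 - β) * (γ - 1)) := by
  have hn' : (0 : ℝ) < n := by positivity
  have h1n : (1 : ℝ) ≤ n := by exact_mod_cast hn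
  have hb : 0 < 1 - β := by linarith
  have hlog : 0 ≤ n * Real.log n / (2 * (1 - β)) :=
    div_nonneg (mul_nonneg hn'.le (Real.log_nonneg h1n)) (by linarith)
  have hnT : n - 1 ≤ T := by
    have : (n : ℝ) ≤ T := by nlinarith
    have : n ≤ T := by exact_mod_cast this
    omega
  obtain ⟨t, rfl⟩ := Nat.exists_eq_add_of_le' hnT
  have ht : n * Real.log n / (2 * (1 - β)) + (γ - 1) * n ≤ t := by
    rw [Nat.cast_add, Nat.cast_sub hn, Nat.cast_one] at hT
    linarith
  have hexp : (1 - (1 - β) / n) ^ t ≤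
      Real.exp (-(Real.log n / 2) + -(1 - β) * (γ - 1)) := by
    have h0 : 0 ≤ 1 - (1 - β) / n := by
      have : (1 - β) / n ≤ 1 := div_le_one_of_le₀ (by linarith) (by linarith)
      linarith
    calc (1 - (1 - β) / n) ^ t ≤ Real.exp (-((1 - β) / n)) ^ t := by
          gcongr
          exact Real.one_sub_le_exp_neg _
      _ = Real.exp (-((1 - β) / n * t)) := by
          rw [← Real.exp_nat_mul]; congr 1; ring
      _ ≤ _ := by
          apply Real.exp_le_exp.2
          have h2 : (1 - β) / n * (n * Real.log n / (2 * (1 - β)) + (γ - 1) * n) ≤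
              (1 - β) / n * t := by gcongr
          have h3 : (1 - β) / n * (n * Real.log n / (2 * (1 - β)) + (γ - 1) * n) =
              Real.log n / 2 + (1 - β) * (γ - 1) := by
            field_simp
          linarith
  have hsqrt : Real.exp (-(Real.log n / 2)) * √n = 1 := by
    rw [Real.sqrt_eq_rpow, Real.rpow_def_of_pos hn', ← Real.exp_add]
    ring_nf
    exact Real.exp_zero
  refine ciSup_le fun σ => (tvDist_glauberLaw_le hβ0 hβ1 hn t σ).trans ?_
  rw [Real.sqrt_mul zero_le_two (n : ℝ)]
  calc (1 - (1 - β) / n) ^ t * (√(2 * (100 * Real.exp 30)) * (√2 * √n)) / 2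
      ≤ (1 - (1 - β) / n) ^ t * (√(2 * (100 * Real.exp 30)) * (√2 * √n)) := by
        refine half_le_self ?_
        refine mul_nonneg (pow_nonneg ?_ _) (by positivity)
        have : (1 - β) / n ≤ 1 := div_le_one_of_le₀ (by linarith) (by linarith)
        linarith
    _ ≤ Real.exp (-(Real.log n / 2) + -(1 - β) * (γ - 1)) *
          (√(2 * (100 * Real.exp 30)) * (√2 * √n)) := by gcongr
    _ = upperConst * Real.exp (-(1 - β) * (γ - 1)) *
          (Real.exp (-(Real.log n / 2)) * √n) := by
        rw [Real.exp_add, upperConst]; ring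
    _ = _ := by rw [hsqrt, mul_one]

/-! ### Drift of the magnetization and the lower bound -/

lemma siteStep_mag (β : ℝ) {n : ℕ} (i : Fin n) (σ : Config n) :
    siteStep β i mag σ =
      mag σ + (Real.tanh (β * (mag σ - spin σ i / n)) - spin σ i) / n := by
  simp only [siteStep, mag_update, plusProb, pPlus, if_true, Bool.false_eq_true, if_false]
  ring

lemma siteStep_mag_sq_le {β : ℝ} (hβ0 : 0 ≤ β) (hβ1 : β < 1) {n : ℕ} (i : Fin n)
    (σ : Config n) :
    siteStep β i (fun η => mag η ^ 2) σ ≤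
      2 * mag σ * siteStep β i mag σ - mag σ ^ 2 + 4 / (n : ℝ) ^ 2 := by
  obtain ⟨h1, h2⟩ := plusProb_mem hβ0 hβ1 σ i
  simp only [siteStep, mag_update, if_true, Bool.false_eq_true, if_false]
  set p := plusProb β σ i
  set s := spin σ i
  have hs : |s| = 1 := abs_spin σ i
  have hs2 := abs_le.1 hs.le
  have h3 : p * (1 - s) ^ 2 + (1 - p) * (-1 - s) ^ 2 ≤ 4 := by
    have : (1 - s) ^ 2 ≤ 4 := by nlinarith
    have : (-1 - s) ^ 2 ≤ 4 := by nlinarith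
    nlinarith
  have h4 : (p * (1 - s) ^ 2 + (1 - p) * (-1 - s) ^ 2) / (n : ℝ) ^ 2 ≤ 4 / (n : ℝ) ^ 2 := by
    gcongr
  have e : p * (mag σ + (1 - s) / n) ^ 2 + (1 - p) * (mag σ + (-1 - s) / n) ^ 2 =
      2 * mag σ * (p * (mag σ + (1 - s) / n) + (1 - p) * (mag σ + (-1 - s) / n)) -
        mag σ ^ 2 + (p * (1 - s) ^ 2 + (1 - p) * (-1 - s) ^ 2) / (n : ℝ) ^ 2 := by
    ring
  linarith

lemma abs_step_mag_sub_le {β : ℝ} (hβ0 : 0 ≤ β) (hβ1 : β < 1) {n : ℕ} (hn : 0 < n)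
    (σ : Config n) :
    |step β mag σ - (mag σ + (Real.tanh (β * mag σ) - mag σ) / n)| ≤ 1 / (n : ℝ) ^ 2 := by
  have hn' : (0 : ℝ) < n := by positivity
  have hsum : ∑ i, spin σ i = n * mag σ := by rw [mag]; field_simp
  have e : step β mag σ - (mag σ + (Real.tanh (β * mag σ) - mag σ) / n) =
      (1 / (n : ℝ) ^ 2) * ∑ i, (Real.tanh (β * (mag σ - spin σ i / n)) -
        Real.tanh (β * mag σ)) := by
    rw [step, Finset.sum_congr rfl fun i _ => siteStep_mag β i σ, Finset.sum_add_distrib,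
      ← Finset.sum_div, Finset.sum_sub_distrib, Finset.sum_sub_distrib, hsum]
    simp only [Finset.sum_const, Finset.card_univ, Fintype.card_fin, nsmul_eq_mul]
    field_simp
    ring
  rw [e, abs_mul, abs_of_nonneg (by positivity)]
  refine mul_le_of_le_one_right (by positivity) ?_
  calc _ ≤ ∑ i, |Real.tanh (β * (mag σ - spin σ i / n)) - Real.tanh (β * mag σ)| :=
        Finset.abs_sum_le_sum_abs _ _
    _ ≤ ∑ _i : Fin n, (1 : ℝ) / n := by
        gcongr with i
        refine (abs_tanh_sub_tanh_le _ _).trans ?_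
        rw [← mul_sub, sub_sub_cancel_left, abs_mul, abs_neg, abs_div, abs_spin, Nat.abs_cast,
          abs_of_nonneg hβ0]
        exact mul_le_of_le_one_left (by positivity) hβ1.le
    _ = 1 := by simp; field_simp

lemma step_mag_sq_le {β : ℝ} (hβ0 : 0 ≤ β) (hβ1 : β < 1) {n : ℕ} (hn : 0 < n)
    (σ : Config n) :
    step β (fun η => mag η ^ 2) σ ≤
      (1 - 2 * ((1 - β) / n)) * mag σ ^ 2 + 6 / (n : ℝ) ^ 2 := by
  have hn' : (0 : ℝ) < n := by positivity
  have h1 : step β (fun η => mag η ^ 2) σ ≤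
      2 * mag σ * step β mag σ - mag σ ^ 2 + 4 / (n : ℝ) ^ 2 := by
    calc step β (fun η => mag η ^ 2) σ
        ≤ (1 / n) * ∑ i, (2 * mag σ * siteStep β i mag σ - mag σ ^ 2 + 4 / (n : ℝ) ^ 2) := by
          rw [step]
          gcongr with i
          exact siteStep_mag_sq_le hβ0 hβ1 i σ
      _ = _ := by
          rw [Finset.sum_add_distrib, Finset.sum_sub_distrib, ← Finset.mul_sum, step]
          simp only [Finset.sum_const, Finset.card_univ, Fintype.card_fin, nsmul_eq_mul]
          field_simp
  have h2 : mag σ * (step β mag σ - (mag σ + (Real.tanh (β * mag σ) - mag σ) / n)) ≤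
      1 / (n : ℝ) ^ 2 := by
    refine (le_abs_self _).trans ?_
    rw [abs_mul]
    exact (mul_le_of_le_one_left (abs_nonneg _) (abs_mag_le_one σ)).trans
      (abs_step_mag_sub_le hβ0 hβ1 hn σ)
  have h3 : mag σ * Real.tanh (β * mag σ) / n ≤ β * mag σ ^ 2 / n := by
    exact div_le_div_of_nonneg_right (mul_tanh_le_sq hβ0) hn'.le
  have e : 2 * mag σ * step β mag σ - mag σ ^ 2 + 4 / (n : ℝ) ^ 2 =
      2 * (mag σ * (step β mag σ - (mag σ + (Real.tanh (β * mag σ) - mag σ) / n))) +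
      2 * (mag σ * Real.tanh (β * mag σ) / n) + (1 - 2 / n) * mag σ ^ 2 + 4 / (n : ℝ) ^ 2 := by
    ring
  have e2 : (1 - 2 * ((1 - β) / n)) * mag σ ^ 2 + 6 / (n : ℝ) ^ 2 =
      2 * (1 / (n : ℝ) ^ 2) + 2 * (β * mag σ ^ 2 / n) + (1 - 2 / n) * mag σ ^ 2 +
        4 / (n : ℝ) ^ 2 := by ring
  linarith

lemma sum_cwMeasure_mul_mag_sq_le {β : ℝ} (hβ0 : 0 ≤ β) (hβ1 : β < 1) {n : ℕ} (hn : 0 < n) :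
    ∑ σ : Config n, cwMeasure β n σ * mag σ ^ 2 ≤ 3 / ((1 - β) * n) := by
  have hn' : (0 : ℝ) < n := by positivity
  have hb : 0 < 1 - β := by linarith
  have h := sum_cwMeasure_mul_step β hn fun η : Config n => mag η ^ 2
  have h2 : ∑ σ, cwMeasure β n σ * step β (fun η => mag η ^ 2) σ ≤
      ∑ σ, cwMeasure β n σ * ((1 - 2 * ((1 - β) / n)) * mag σ ^ 2 + 6 / (n : ℝ) ^ 2) := by
    gcongr with σ
    · exact cwMeasure_nonneg β σ
    · exact step_mag_sq_le hβ0 hβ1 hn σ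
  have h3 : ∑ σ, cwMeasure β n σ * ((1 - 2 * ((1 - β) / n)) * mag σ ^ 2 + 6 / (n : ℝ) ^ 2) =
      (1 - 2 * ((1 - β) / n)) * ∑ σ, cwMeasure β n σ * mag σ ^ 2 + 6 / (n : ℝ) ^ 2 := by
    simp only [mul_add]
    rw [Finset.sum_add_distrib, ← Finset.sum_mul, sum_cwMeasure, one_mul, Finset.mul_sum]
    congr 1
    exact Finset.sum_congr rfl fun σ _ => by ring
  rw [h, h3] at h2
  rw [le_div_iff₀ (by positivity)]
  have h4 : 2 * ((1 - β) / n) * ∑ σ, cwMeasure β n σ * mag σ ^ 2 ≤ 6 / (n : ℝ) ^ 2 := by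
    linarith
  rw [le_div_iff₀ (by positivity)] at h4
  have e : 2 * ((1 - β) / n) * (∑ σ, cwMeasure β n σ * mag σ ^ 2) * (n : ℝ) ^ 2 =
      2 * ((∑ σ, cwMeasure β n σ * mag σ ^ 2) * ((1 - β) * n)) := by
    field_simp
  linarith

lemma le_step_mag {β : ℝ} (hβ0 : 0 ≤ β) (hβ1 : β < 1) {n : ℕ} (hn : 0 < n) (σ : Config n) :
    (1 - (1 - β) / n) * mag σ - mag σ ^ 2 / n - 1 / (n : ℝ) ^ 2 ≤ step β mag σ := by
  have hn' : (0 : ℝ) < n := by positivity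
  have h1 := (abs_le.1 (abs_step_mag_sub_le hβ0 hβ1 hn σ)).1
  have h2 : (β * mag σ - mag σ ^ 2) / n ≤ Real.tanh (β * mag σ) / n := by
    gcongr
    refine le_trans ?_ (sub_sq_le_tanh _)
    have : β ^ 2 * mag σ ^ 2 ≤ mag σ ^ 2 :=
      mul_le_of_le_one_left (sq_nonneg _) (pow_le_one₀ hβ0 hβ1.le)
    linarith [mul_pow β (mag σ) 2]
  have e : (1 - (1 - β) / n) * mag σ - mag σ ^ 2 / n - 1 / (n : ℝ) ^ 2 =
      mag σ + ((β * mag σ - mag σ ^ 2) / n - mag σ / n) - 1 / (n : ℝ) ^ 2 := by ring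
  rw [sub_div] at h1
  linarith

lemma le_step_iterate_of_le_step {β : ℝ} (hβ0 : 0 ≤ β) (hβ1 : β < 1) {n : ℕ} (hn : 0 < n)
    {g : Config n → ℝ} {ρ c : ℝ} (hρ : 0 ≤ ρ)
    (hg : ∀ σ, ρ * g σ - (1 - ρ) * c ≤ step β g σ) (t : ℕ) (σ : Config n) :
    ρ ^ t * g σ - (1 - ρ ^ t) * c ≤ (step β)^[t] g σ := by
  induction t generalizing σ with
  | zero => simp
  | succ t ih =>
    rw [Function.iterate_succ_apply']
    calc ρ ^ (t + 1) * g σ - (1 - ρ ^ (t + 1)) * c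
        = ρ ^ t * (ρ * g σ - (1 - ρ) * c) - (1 - ρ ^ t) * c := by ring
      _ ≤ ρ ^ t * step β g σ - (1 - ρ ^ t) * c := by
          have := mul_le_mul_of_nonneg_left (hg σ) (pow_nonneg hρ t)
          linarith
      _ = step β (fun η => ρ ^ t * g η - (1 - ρ ^ t) * c) σ := by
          rw [step_sub, step_const_mul, step_const β hn]
      _ ≤ _ := step_mono hβ0 hβ1 ih σ

lemma le_step_iterate_mag {β : ℝ} (hβ0 : 0 ≤ β) (hβ1 : β < 1) {n : ℕ} (hn : 0 < n) (t : ℕ)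
    (σ : Config n) :
    (1 - (1 - β) / n) ^ t * (mag σ - mag σ ^ 2 / (1 - β)) - 7 / ((1 - β) ^ 2 * n) ≤
      (step β)^[t] mag σ := by
  have hn' : (0 : ℝ) < n := by positivity
  have hb : 0 < 1 - β := by linarith
  have h1n : (1 : ℝ) ≤ n := by exact_mod_cast hn
  have hρ : 0 ≤ 1 - (1 - β) / n := by
    have : (1 - β) / n ≤ 1 := div_le_one_of_le₀ (by linarith) (by linarith)
    linarith
  have hg : ∀ η : Config n,
      (1 - (1 - β) / n) * (mag η - (1 / (1 - β)) * mag η ^ 2) -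
        (1 - (1 - (1 - β) / n)) * (7 / ((1 - β) ^ 2 * n)) ≤
      step β (fun η => mag η - (1 / (1 - β)) * mag η ^ 2) η := by
    intro η
    rw [step_sub, step_const_mul]
    have h1 := le_step_mag hβ0 hβ1 hn η
    have h2 := mul_le_mul_of_nonneg_left (step_mag_sq_le hβ0 hβ1 hn η)
      (one_div_nonneg.2 hb.le)
    have h3 : 1 / (n : ℝ) ^ 2 ≤ 1 / ((1 - β) * (n : ℝ) ^ 2) :=
      one_div_le_one_div_of_le (by positivity)
        (mul_le_of_le_one_left (by positivity) (by linarith))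
    have e1 : 1 / (1 - β) * ((1 - 2 * ((1 - β) / n)) * mag η ^ 2 + 6 / (n : ℝ) ^ 2) =
        1 / (1 - β) * mag η ^ 2 - 2 * mag η ^ 2 / n + 6 * (1 / ((1 - β) * (n : ℝ) ^ 2)) := by
      field_simp
    have e2 : (1 - (1 - β) / n) * (mag η - (1 / (1 - β)) * mag η ^ 2) -
        (1 - (1 - (1 - β) / n)) * (7 / ((1 - β) ^ 2 * n)) =
        (1 - (1 - β) / n) * mag η - 1 / (1 - β) * mag η ^ 2 + mag η ^ 2 / n -
          7 * (1 / ((1 - β) * (n : ℝ) ^ 2)) := by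
      field_simp
      ring
    have e3 : 2 * mag η ^ 2 / n = mag η ^ 2 / n + mag η ^ 2 / n := by ring
    linarith
  have h := le_step_iterate_of_le_step hβ0 hβ1 hn hρ hg t σ
  have hle : (step β)^[t] (fun η => mag η - (1 / (1 - β)) * mag η ^ 2) σ ≤
      (step β)^[t] mag σ :=
    step_iterate_mono hβ0 hβ1 t (fun η => by
      have : 0 ≤ 1 / (1 - β) * mag η ^ 2 := by positivity
      linarith) σ
  have h5 : 0 ≤ (1 - (1 - β) / n) ^ t * (7 / ((1 - β) ^ 2 * n)) := by positivity
  have e4 : (1 - (1 - β) / n) ^ t * (mag σ - mag σ ^ 2 / (1 - β)) =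
    (1 - (1 - β) / n) ^ t * (mag σ - (1 / (1 - β)) * mag σ ^ 2) := by ring
  linarith

lemma discDeriv_mag {n : ℕ} (i : Fin n) (σ : Config n) : discDeriv mag i σ = 2 / n := by
  simp only [discDeriv, mag_update, if_true, Bool.false_eq_true, if_false]
  ring

lemma iterVar_mag_le {β : ℝ} (hβ0 : 0 ≤ β) (hβ1 : β < 1) {n : ℕ} (hn : 0 < n) (t : ℕ)
    (σ : Config n) :
    iterVar β t mag σ ≤ 4 / ((1 - β) * n) * (1 - (1 - (1 - β) / n) ^ t) := by
  have hn' : (0 : ℝ) < n := by positivity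
  have hb : 0 < 1 - β := by linarith
  have h1n : (1 : ℝ) ≤ n := by exact_mod_cast hn
  have hρ : 0 ≤ 1 - (1 - β) / n := by
    have : (1 - β) / n ≤ 1 := div_le_one_of_le₀ (by linarith) (by linarith)
    linarith
  have hρ1 : 1 - (1 - β) / n ≤ 1 := by
    have : 0 ≤ (1 - β) / n := by positivity
    linarith
  induction t generalizing σ with
  | zero => simp [iterVar]
  | succ t ih =>
    have hvar : stepVar β ((step β)^[t] mag) σ ≤ ((1 - (1 - β) / n) ^ t * (2 / n)) ^ 2 :=
      stepVar_le hβ0 hβ1 hn (fun i η => abs_discDeriv_iterate_le_const hβ0 hβ1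
        (fun j ξ => by rw [discDeriv_mag, abs_of_nonneg (by positivity)]) t i η) σ
    have hmono := step_mono hβ0 hβ1 ih σ
    rw [step_const β hn] at hmono
    have hpow : ((1 - (1 - β) / n) ^ t * (2 / n)) ^ 2 ≤
        (1 - (1 - β) / n) ^ t * (4 / (n : ℝ) ^ 2) := by
      have h0 : 0 ≤ (1 - (1 - β) / n) ^ t := pow_nonneg hρ t
      have h1 : (1 - (1 - β) / n) ^ t ≤ 1 := pow_le_one₀ hρ hρ1
      calc ((1 - (1 - β) / n) ^ t * (2 / n)) ^ 2
          = (1 - (1 - β) / n) ^ t * ((1 - (1 - β) / n) ^ t * (4 / (n : ℝ) ^ 2)) := by ring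
        _ ≤ (1 - (1 - β) / n) ^ t * (1 * (4 / (n : ℝ) ^ 2)) := by gcongr
        _ = _ := by rw [one_mul]
    rw [iterVar_succ]
    have e : 4 / ((1 - β) * n) * (1 - (1 - (1 - β) / n) ^ (t + 1)) =
        4 / ((1 - β) * n) * (1 - (1 - (1 - β) / n) ^ t) +
          (1 - (1 - β) / n) ^ t * (4 / (n : ℝ) ^ 2) := by
      rw [pow_succ (1 - (1 - β) / (n : ℝ)) t]
      field_simp
      ring
    linarith

lemma sum_mul_sub_le_tvDist {Ω : Type*} [Fintype Ω] {μ ν f : Ω → ℝ}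
    (hμν : ∑ x, μ x = ∑ x, ν x) (hf : ∀ x, 0 ≤ f x ∧ f x ≤ 1) :
    ∑ x, μ x * f x - ∑ x, ν x * f x ≤ tvDist μ ν := by
  have h : ∑ x, (f x - 1 / 2) * (μ x - ν x) ≤ ∑ x, |μ x - ν x| / 2 := by
    refine Finset.sum_le_sum fun x _ => (le_abs_self _).trans ?_
    rw [abs_mul]
    have h1 : |f x - 1 / 2| ≤ 1 / 2 :=
      abs_le.2 ⟨by linarith [(hf x).1], by linarith [(hf x).2]⟩
    calc |f x - 1 / 2| * |μ x - ν x| ≤ 1 / 2 * |μ x - ν x| := by gcongr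
      _ = _ := by ring
  have e : ∑ x, (f x - 1 / 2) * (μ x - ν x) =
      ∑ x, μ x * f x - ∑ x, ν x * f x - 1 / 2 * (∑ x, μ x - ∑ x, ν x) := by
    rw [← Finset.sum_sub_distrib, ← Finset.sum_sub_distrib, Finset.mul_sum,
      ← Finset.sum_sub_distrib]
    exact Finset.sum_congr rfl fun x _ => by ring
  rw [e, hμν, sub_self, mul_zero, sub_zero, ← Finset.sum_div] at h
  exact h

lemma one_sub_le_tvDist_of_mean_pos {β : ℝ} (hβ0 : 0 ≤ β) (hβ1 : β < 1) {n : ℕ} (hn : 0 < n)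
    (t : ℕ) (σ : Config n) {m : ℝ} (hm : 0 < m) (hmean : m ≤ (step β)^[t] mag σ) :
    1 - 28 / ((1 - β) * n * m ^ 2) ≤ tvDist (glauberLaw β n t σ) (cwMeasure β n) := by
  have hn' : (0 : ℝ) < n := by positivity
  have hb : 0 < 1 - β := by linarith
  have h1n : (1 : ℝ) ≤ n := by exact_mod_cast hn
  set M := (step β)^[t] mag σ with hM
  have hM0 : 0 < M := hm.trans_le hmean
  have hvar : iterVar β t mag σ ≤ 4 / ((1 - β) * n) := by
    refine (iterVar_mag_le hβ0 hβ1 hn t σ).trans (mul_le_of_le_one_right (by positivity) ?_)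
    have : (1 - β) / n ≤ 1 := div_le_one_of_le₀ (by linarith) (by linarith)
    have : 0 ≤ (1 - (1 - β) / n) ^ t := pow_nonneg (by linarith) t
    linarith
  let f : Config n → ℝ := fun η => if M / 2 ≤ mag η then 1 else 0
  have hf : ∀ η, 0 ≤ f η ∧ f η ≤ 1 := fun η => by
    simp only [f]; split_ifs <;> norm_num
  have hf1 : ∀ η, 1 - 4 / M ^ 2 * (mag η - M) ^ 2 ≤ f η := fun η => by
    simp only [f]
    split_ifs with h
    · have : 0 ≤ 4 / M ^ 2 * (mag η - M) ^ 2 := by positivity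
      linarith
    · have h2 : 1 ≤ 4 / M ^ 2 * (mag η - M) ^ 2 := by
        rw [div_mul_eq_mul_div, le_div_iff₀ (by positivity)]
        nlinarith
      linarith
  have hf2 : ∀ η, f η ≤ 4 / M ^ 2 * mag η ^ 2 := fun η => by
    simp only [f]
    split_ifs with h
    · rw [div_mul_eq_mul_div, le_div_iff₀ (by positivity)]
      nlinarith
    · positivity
  have hlaw : 1 - 4 / M ^ 2 * (4 / ((1 - β) * n)) ≤ ∑ η, glauberLaw β n t σ η * f η := by
    calc 1 - 4 / M ^ 2 * (4 / ((1 - β) * n)) ≤ 1 - 4 / M ^ 2 * iterVar β t mag σ := by gcongr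
      _ = ∑ η, glauberLaw β n t σ η * (1 - 4 / M ^ 2 * (mag η - M) ^ 2) := by
          have h1 := sum_glauberLaw_mul β t (fun η => mag η ^ 2) σ
          have h2 := sum_glauberLaw_mul β t mag σ
          have h3 := sum_glauberLaw β hn t σ
          have e : ∀ η, glauberLaw β n t σ η * (1 - 4 / M ^ 2 * (mag η - M) ^ 2) =
              (1 - 4 / M ^ 2 * M ^ 2) * glauberLaw β n t σ η -
              4 / M ^ 2 * (glauberLaw β n t σ η * mag η ^ 2) +
              4 / M ^ 2 * (2 * M) * (glauberLaw β n t σ η * mag η) := fun η => by ring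
          rw [Finset.sum_congr rfl fun η _ => e η, Finset.sum_add_distrib,
            Finset.sum_sub_distrib, ← Finset.mul_sum, ← Finset.mul_sum, ← Finset.mul_sum,
            h1, h2, h3, iterVar, ← hM]
          ring
      _ ≤ _ := by
          gcongr with η
          · exact glauberLaw_nonneg hβ0 hβ1 hn t σ η
          · exact hf1 η
  have hcw : ∑ η, cwMeasure β n η * f η ≤ 4 / M ^ 2 * (3 / ((1 - β) * n)) := by
    calc ∑ η, cwMeasure β n η * f η ≤ ∑ η, cwMeasure β n η * (4 / M ^ 2 * mag η ^ 2) := by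
          gcongr with η
          · exact cwMeasure_nonneg β η
          · exact hf2 η
      _ = 4 / M ^ 2 * ∑ η, cwMeasure β n η * mag η ^ 2 := by
          rw [Finset.mul_sum]
          exact Finset.sum_congr rfl fun η _ => by ring
      _ ≤ _ := by
          gcongr
          exact sum_cwMeasure_mul_mag_sq_le hβ0 hβ1 hn
  have htv := sum_mul_sub_le_tvDist
    ((sum_glauberLaw β hn t σ).trans (sum_cwMeasure β n).symm) hf
  have e : 28 / ((1 - β) * n * M ^ 2) =
      4 / M ^ 2 * (4 / ((1 - β) * n)) + 4 / M ^ 2 * (3 / ((1 - β) * n)) := by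
    field_simp
    norm_num
  have hmM : 28 / ((1 - β) * n * M ^ 2) ≤ 28 / ((1 - β) * n * m ^ 2) := by gcongr
  linarith

lemma exists_mag_mem {n : ℕ} {b : ℝ} (hb0 : 0 < b) (hb1 : b ≤ 1) (hn : 8 ≤ n * b) :
    ∃ σ : Config n, b / 4 ≤ mag σ ∧ mag σ ≤ b / 2 := by
  have hn' : (0 : ℝ) < n := pos_of_mul_pos_left (by linarith) hb0.le
  set k := ⌈n * (1 + b / 4) / 2⌉₊ with hk
  have h1 : n * (1 + b / 4) / 2 ≤ k := Nat.le_ceil _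
  have h2 : (k : ℝ) < n * (1 + b / 4) / 2 + 1 := Nat.ceil_lt_add_one (by positivity)
  have hkn : k ≤ n := by
    have : (k : ℝ) ≤ n := by nlinarith
    exact_mod_cast this
  have hmag : mag (fun i : Fin n => decide ((i : ℕ) < k)) = (2 * k - n) / n := by
    have h3 : ∀ i : Fin n, spin (fun i : Fin n => decide ((i : ℕ) < k)) i =
        2 * (if (i : ℕ) < k then 1 else 0) - 1 := fun i => by
      by_cases h : (i : ℕ) < k <;> norm_num [spin, h]
    rw [mag, Finset.sum_congr rfl fun i _ => h3 i, Finset.sum_sub_distrib, ← Finset.mul_sum,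
      Finset.sum_boole, Fin.card_filter_val_lt, min_eq_right hkn]
    simp
  refine ⟨fun i => decide ((i : ℕ) < k), ?_, ?_⟩
  · rw [hmag, le_div_iff₀ hn']
    linarith
  · rw [hmag, div_le_iff₀ hn']
    linarith

lemma exp_neg_add_sq_le {x : ℝ} (hx0 : 0 ≤ x) (hx : x ≤ 1 / 2) :
    Real.exp (-(x + x ^ 2)) ≤ 1 - x := by
  have h := Real.quadratic_le_exp_of_nonneg (x := x + x ^ 2) (by positivity)
  rw [Real.exp_neg, inv_le_comm₀ (Real.exp_pos _) (by linarith), inv_eq_one_div,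
    div_le_iff₀ (by linarith)]
  have h2 : 1 + x + 3 / 2 * x ^ 2 + x ^ 3 ≤ Real.exp (x + x ^ 2) := by
    refine le_trans ?_ h
    have : 0 ≤ x ^ 4 := by positivity
    linarith [show (x + x ^ 2) ^ 2 = x ^ 2 + 2 * x ^ 3 + x ^ 4 by ring]
  have h3 : 0 ≤ x ^ 2 * (1 / 2 - x / 2 - x ^ 2) := mul_nonneg (by positivity) (by nlinarith)
  calc 1 ≤ (1 + x + 3 / 2 * x ^ 2 + x ^ 3) * (1 - x) := by linarith
    _ ≤ _ := by
        gcongr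
        linarith

/-- Constant in the lower bound on the distance to equilibrium. -/
def lowerConst (β : ℝ) : ℝ := (1 - β) / 16 * Real.exp (-(1 / 2))

lemma lowerConst_pos {β : ℝ} (hβ1 : β < 1) : 0 < lowerConst β :=
  mul_pos (by linarith) (Real.exp_pos _)

lemma le_glauberDist_of_time_le {β : ℝ} (hβ0 : 0 ≤ β) (hβ1 : β < 1) {n T : ℕ} {γ : ℝ}
    (hγ : 0 ≤ γ) (hn : 8 ≤ n * (1 - β)) (hn2 : 7 / ((1 - β) ^ 2 * √n) ≤ lowerConst β)
    (hT : T ≤ n * Real.log n / (2 * (1 - β)) - γ * n) :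
    1 - 28 / ((1 - β) * lowerConst β ^ 2) * Real.exp (-(2 * (1 - β)) * γ) ≤
      glauberDist β n T := by
  have hb : 0 < 1 - β := by linarith
  have hn' : (0 : ℝ) < n := pos_of_mul_pos_left (by linarith) hb.le
  have hn0 : 0 < n := by exact_mod_cast hn'
  obtain ⟨σ, hσ1, hσ2⟩ := exists_mag_mem hb (by linarith) hn
  have hW : (1 - β) / 8 ≤ mag σ - mag σ ^ 2 / (1 - β) := by
    have : mag σ ^ 2 / (1 - β) ≤ mag σ / 2 := by
      rw [div_le_iff₀ hb]
      nlinarith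
    linarith
  have hx0 : 0 ≤ (1 - β) / n := by positivity
  have hx : (1 - β) / n ≤ 1 / 2 := by
    rw [div_le_iff₀ hn']
    nlinarith
  have hsqrt : Real.exp (-(Real.log n / 2)) = 1 / √n := by
    rw [Real.sqrt_eq_rpow, Real.rpow_def_of_pos hn', one_div (Real.exp _), ← Real.exp_neg]
    ring_nf
  have hpow : Real.exp (-(1 / 2)) * Real.exp ((1 - β) * γ) / √n ≤ (1 - (1 - β) / n) ^ T := by
    calc Real.exp (-(1 / 2)) * Real.exp ((1 - β) * γ) / √n
        = Real.exp (-(1 / 2) + (1 - β) * γ + -(Real.log n / 2)) := by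
          rw [Real.exp_add, Real.exp_add, hsqrt]; ring
      _ ≤ Real.exp (T * -((1 - β) / n + ((1 - β) / n) ^ 2)) := by
          apply Real.exp_le_exp.2
          have h1 : (1 - β) / n * T ≤
              (1 - β) / n * (n * Real.log n / (2 * (1 - β)) - γ * n) := by gcongr
          have e1 : (1 - β) / n * (n * Real.log n / (2 * (1 - β)) - γ * n) =
              Real.log n / 2 - (1 - β) * γ := by field_simp
          have h2 : (1 - β) / n * T ≤ n / 2 := by
            have := Real.log_le_self hn'.le
            have : 0 ≤ (1 - β) * γ := by positivity
            linarith
          have h3 : (1 - β) / n * ((1 - β) / n * T) ≤ 1 / n * (n / 2) := by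
            gcongr
            linarith
          have e3 : 1 / (n : ℝ) * (n / 2) = 1 / 2 := by field_simp
          linarith
      _ = Real.exp (-((1 - β) / n + ((1 - β) / n) ^ 2)) ^ T := Real.exp_nat_mul _ _
      _ ≤ _ := by
          gcongr
          exact exp_neg_add_sq_le hx0 hx
  have hexp1 : 1 ≤ Real.exp ((1 - β) * γ) := Real.one_le_exp (by positivity)
  have hc := lowerConst_pos hβ1
  have hs : 0 < √(n : ℝ) := Real.sqrt_pos.2 hn'
  have hmean : lowerConst β * Real.exp ((1 - β) * γ) / √n ≤ (step β)^[T] mag σ := by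
    refine le_trans ?_ (le_step_iterate_mag hβ0 hβ1 hn0 T σ)
    have h1 : Real.exp (-(1 / 2)) * Real.exp ((1 - β) * γ) / √n * ((1 - β) / 8) ≤
        (1 - (1 - β) / n) ^ T * (mag σ - mag σ ^ 2 / (1 - β)) :=
      mul_le_mul hpow hW (by positivity) (pow_nonneg (by linarith) T)
    have h2 : 7 / ((1 - β) ^ 2 * n) ≤ lowerConst β * Real.exp ((1 - β) * γ) / √n := by
      calc 7 / ((1 - β) ^ 2 * n) = 7 / ((1 - β) ^ 2 * √n) / √n := by
            rw [div_div, mul_assoc, Real.mul_self_sqrt hn'.le]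
        _ ≤ lowerConst β / √n := by gcongr
        _ ≤ _ := by
            gcongr
            exact le_mul_of_one_le_right hc.le hexp1
    have e : Real.exp (-(1 / 2)) * Real.exp ((1 - β) * γ) / √n * ((1 - β) / 8) =
        2 * (lowerConst β * Real.exp ((1 - β) * γ) / √n) := by
      rw [lowerConst]; ring
    linarith
  refine le_trans ?_ ((one_sub_le_tvDist_of_mean_pos hβ0 hβ1 hn0 T σ (by positivity) hmean).trans
    (tvDist_le_glauberDist β n T σ))
  apply le_of_eq
  have e : Real.exp (-(2 * (1 - β)) * γ) = 1 / Real.exp ((1 - β) * γ) ^ 2 := by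
    rw [← Real.exp_nat_mul, one_div, ← Real.exp_neg]
    congr 1
    push_cast
    ring
  rw [e, div_pow, mul_pow, Real.sq_sqrt hn'.le]
  field_simp

/-- Cut-off for the Glauber dynamics of the Curie-Weiss model at high
temperature (`0 ≤ β < 1`), at `tₙ = n log n / (2(1-β))` with window of size `n`:
the worst-case total variation distance tends to `1` before the cut-off time
and to `0` after it. -/
theorem cw_cutoff (β : ℝ) (hβ0 : 0 ≤ β) (hβ1 : β < 1) :
    Tendsto (fun γ : ℝ =>
        liminf (fun n : ℕ =>
          glauberDist β n ⌊(n : ℝ) * Real.log n / (2 * (1 - β)) - γ * n⌋₊) atTop)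
      atTop (nhds 1) ∧
    Tendsto (fun γ : ℝ =>
        limsup (fun n : ℕ =>
          glauberDist β n ⌈(n : ℝ) * Real.log n / (2 * (1 - β)) + γ * n⌉₊) atTop)
      atTop (nhds 0) := by
  have hb : 0 < 1 - β := by linarith
  have hbdd : ∀ T : ℕ → ℕ, ∀ᶠ n in atTop, 0 ≤ glauberDist β n (T n) ∧
      glauberDist β n (T n) ≤ 1 := fun T => by
    filter_upwards [eventually_gt_atTop 0] with n hn
    exact ⟨glauberDist_nonneg _ _ _, glauberDist_le_one hβ0 hβ1 hn _⟩
  have hexp : ∀ c : ℝ, 0 < c → Tendsto (fun γ : ℝ => Real.exp (-c * γ)) atTop (nhds 0) :=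
    fun c hc => Real.tendsto_exp_atBot.comp
      (tendsto_id.const_mul_atTop_of_neg (neg_neg_of_pos hc))
  constructor
  · have hlim : Tendsto (fun γ : ℝ => 1 - 28 / ((1 - β) * lowerConst β ^ 2) *
        Real.exp (-(2 * (1 - β)) * γ)) atTop (nhds 1) := by
      simpa using ((hexp (2 * (1 - β)) (by linarith)).const_mul
        (28 / ((1 - β) * lowerConst β ^ 2))).const_sub 1
    refine tendsto_of_tendsto_of_tendsto_of_le_of_le' hlim tendsto_const_nhds ?_ ?_
    · filter_upwards [eventually_ge_atTop 0] with γ hγ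
      refine le_liminf_of_le
        (isBoundedUnder_of_eventually_le ((hbdd _).mono fun _ h => h.2)).isCoboundedUnder_ge ?_
      have h1 : ∀ᶠ n : ℕ in atTop, 8 ≤ (n : ℝ) * (1 - β) :=
        (tendsto_natCast_atTop_atTop.atTop_mul_const hb).eventually_ge_atTop 8
      have h2 : ∀ᶠ n : ℕ in atTop, 7 / ((1 - β) ^ 2 * √n) ≤ lowerConst β :=
        (((Real.tendsto_sqrt_atTop.comp tendsto_natCast_atTop_atTop).const_mul_atTop
          (by positivity : 0 < (1 - β) ^ 2)).const_div_atTop 7).eventually_le_const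
          (lowerConst_pos hβ1)
      have h3 : ∀ᶠ n : ℕ in atTop, 2 * (1 - β) * γ ≤ Real.log n :=
        (Real.tendsto_log_atTop.comp tendsto_natCast_atTop_atTop).eventually_ge_atTop _
      filter_upwards [h1, h2, h3] with n h1 h2 h3
      refine le_glauberDist_of_time_le hβ0 hβ1 hγ h1 h2 (Nat.floor_le ?_)
      rw [sub_nonneg, le_div_iff₀ (by linarith)]
      calc γ * n * (2 * (1 - β)) = n * (2 * (1 - β) * γ) := by ring
        _ ≤ n * Real.log n := by gcongr
    · refine Eventually.of_forall fun γ => liminf_le_of_le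
        (isBoundedUnder_of_eventually_ge ((hbdd _).mono fun _ h => h.1)) fun b hbound => ?_
      obtain ⟨n, h1, h2⟩ := (hbound.and (hbdd _)).exists
      exact h1.trans h2.2
  · have hlim : Tendsto (fun γ : ℝ => upperConst * Real.exp (-(1 - β) * (γ - 1))) atTop
        (nhds 0) := by
      simpa [sub_eq_add_neg] using ((hexp (1 - β) hb).comp
        (tendsto_atTop_add_const_right atTop (-1) tendsto_id)).const_mul upperConst
    refine tendsto_of_tendsto_of_tendsto_of_le_of_le' tendsto_const_nhds hlim ?_ ?_
    · refine Eventually.of_forall fun γ => le_limsup_of_le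
        (isBoundedUnder_of_eventually_le ((hbdd _).mono fun _ h => h.2)) fun b hbound => ?_
      obtain ⟨n, h1, h2⟩ := (hbound.and (hbdd _)).exists
      exact h2.1.trans h1
    · filter_upwards [eventually_ge_atTop 1] with γ hγ
      refine limsup_le_of_le
        (isBoundedUnder_of_eventually_ge ((hbdd _).mono fun _ h => h.1)).isCoboundedUnder_le ?_
      filter_upwards [eventually_gt_atTop 0] with n hn
      exact glauberDist_le_of_time_ge hβ0 hβ1 hn hγ (Nat.le_ceil _)

end

end CW
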